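/- arXiv:1805.01207 — 3 statements merged into one kernel-verified Lean document; each statement's English description precedes it below -/
import Mathlib

section
/- In a multiplicative hom-associative algebra (A, μ, α), the bracket of two cocycles is a cocycle, and the bracket of a cocycle with a coboundary is a coboundary; hence [-,-]_α descends to a well-defined degree -1 graded Lie bracket on the cohomology H•_α(A,A). -/
/-- Reindex a tuple along an equality of lengths. -/
def reindex {A : Type*} {p q : ℕ} (h : q = p) (a : Fin p → A) : Fin q → A :=
  fun k => a (Fin.cast h k)

/-- `f` commutes with `α`, i.e. `α ∘ f = f ∘ α^{⊗n}` (membership condition for `Cⁿ_α`/`V^α`). -/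
def IsCompat {A : Type*} (α : A → A) {n : ℕ} (f : (Fin n → A) → A) : Prop :=
  ∀ a : Fin n → A, α (f a) = f fun i => α (a i)

/-- The α-twisted Hochschild coboundary on `n`-cochains. -/
def homDelta {A : Type*} [AddCommGroup A] (μ : A → A → A) (α : A → A) (n : ℕ)
    (f : (Fin n → A) → A) : (Fin (n + 1) → A) → A := fun a =>
  μ (α^[n - 1] (a 0)) (f fun i => a i.succ)
    + ∑ i : Fin n, ((-1 : ℤ) ^ ((i : ℕ) + 1)) •
        f (fun j => if (j : ℕ) < (i : ℕ) then α (a j.castSucc)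
          else if (j : ℕ) = (i : ℕ) then μ (a j.castSucc) (a j.succ)
          else α (a j.succ))
    + ((-1 : ℤ) ^ (n + 1)) • μ (f fun i => a i.castSucc) (α^[n - 1] (a (Fin.last n)))

/-- The α-twisted insertion `f ∘ᵢ g` for `f ∈ V^α_m`, `g ∈ V^α_n`. -/
def circI {A : Type*} (α : A → A) {m n : ℕ} (i : Fin (m + 1))
    (f : (Fin (m + 1) → A) → A) (g : (Fin (n + 1) → A) → A) :
    (Fin (m + n + 1) → A) → A := fun a =>
  f fun k => if (k : ℕ) < (i : ℕ) then α^[n] (a ⟨(k : ℕ), by omega⟩)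
    else if (k : ℕ) = (i : ℕ) then g (fun l => a ⟨(i : ℕ) + (l : ℕ), by omega⟩)
    else α^[n] (a ⟨(k : ℕ) + n, by omega⟩)

/-- The α-twisted pre-Lie product `f ∘ g = Σᵢ (-1)^{ni} f ∘ᵢ g`. -/
def vcirc {A : Type*} [AddCommGroup A] (α : A → A) {m n : ℕ}
    (f : (Fin (m + 1) → A) → A) (g : (Fin (n + 1) → A) → A) :
    (Fin (m + n + 1) → A) → A := fun a =>
  ∑ i : Fin (m + 1), ((-1 : ℤ) ^ (n * (i : ℕ))) • circI α i f g a

/-- The graded (Gerstenhaber) bracket `[f,g] = f ∘ g - (-1)^{mn} g ∘ f` on `⊕ V^α_m`. -/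
def vbracket {A : Type*} [AddCommGroup A] (α : A → A) {m n : ℕ}
    (f : (Fin (m + 1) → A) → A) (g : (Fin (n + 1) → A) → A) :
    (Fin (m + n + 1) → A) → A := fun a =>
  vcirc α f g a - ((-1 : ℤ) ^ (m * n)) • vcirc α g f (reindex (by omega) a)

/-- The cup product of an `(m+1)`-cochain and an `(n+1)`-cochain. -/
def cupProd {A : Type*} (μ : A → A → A) (α : A → A) {m n : ℕ}
    (f : (Fin (m + 1) → A) → A) (g : (Fin (n + 1) → A) → A) :
    (Fin (m + n + 2) → A) → A := fun a =>
  μ (α^[n] (f fun i => a ⟨(i : ℕ), by omega⟩))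
    (α^[m] (g fun i => a ⟨m + 1 + (i : ℕ), by omega⟩))

section Seq

variable {K : Type*} [Field K] {A : Type*} [AddCommGroup A] [Module K A]

/-- insertion of `x` at position `i` -/
def sIns (α : A → A) (i n : ℕ) (x : A) (a : ℕ → A) : ℕ → A := fun k =>
  if k < i then α^[n] (a k) else if k = i then x else α^[n] (a (k + n))

def sC (α : A → A) (i n : ℕ) (F G : (ℕ → A) → A) : (ℕ → A) → A := fun a =>
  F (sIns α i n (G fun l => a (i + l)) a)

def sCirc (α : A → A) (m n : ℕ) (F G : (ℕ → A) → A) : (ℕ → A) → A :=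
  ∑ i ∈ Finset.range (m + 1), ((-1 : ℤ) ^ (n * i)) • sC α i n F G

def sBr (α : A → A) (m n : ℕ) (F G : (ℕ → A) → A) : (ℕ → A) → A :=
  sCirc α m n F G - ((-1 : ℤ) ^ (m * n)) • sCirc α n m G F

def sLoc (m : ℕ) (F : (ℕ → A) → A) : Prop :=
  ∀ a b : ℕ → A, (∀ k, k ≤ m → a k = b k) → F a = F b

def sLin (K : Type*) [Field K] {A : Type*} [AddCommGroup A] [Module K A]
    (m : ℕ) (F : (ℕ → A) → A) : Prop :=
  ∀ i, i ≤ m → ∀ a : ℕ → A, ∃ L : A →ₗ[K] A, ∀ x, F (Function.update a i x) = L x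

def sCompat (α : A → A) (F : (ℕ → A) → A) : Prop :=
  ∀ a : ℕ → A, α (F a) = F fun i => α (a i)

structure sGood (α : A →ₗ[K] A) (m : ℕ) (F : (ℕ → A) → A) : Prop where
  loc : sLoc m F
  lin : sLin K m F
  compat : sCompat (⇑α) F

theorem sCompat_iter {α : A → A} {F : (ℕ → A) → A} (h : sCompat α F) (n : ℕ) (a : ℕ → A) :
    α^[n] (F a) = F fun i => α^[n] (a i) := by
  induction n with
  | zero => rfl
  | succ n ih => simp only [Function.iterate_succ_apply', ih]; exact h _

theorem sIns_eq_update (α : A → A) (i n : ℕ) (x : A) (a : ℕ → A) :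
    sIns α i n x a = Function.update (sIns α i n x a) i x := by
  funext k; by_cases h : k = i
  · subst h; simp [sIns]
  · simp [h]

theorem sIns_eq_update' (α : A → A) (i n : ℕ) (x y : A) (a : ℕ → A) :
    sIns α i n x a = Function.update (sIns α i n y a) i x := by
  funext k; by_cases h : k = i
  · subst h; simp [sIns]
  · simp [h, sIns]

theorem sIns_lin {m : ℕ} {F : (ℕ → A) → A} (hF : sLin K m F) (α : A → A) (i n : ℕ) (hi : i ≤ m)
    (a : ℕ → A) : ∃ L : A →ₗ[K] A, ∀ x, F (sIns α i n x a) = L x := by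
  obtain ⟨L, hL⟩ := hF i hi (sIns α i n 0 a)
  exact ⟨L, fun x => by rw [sIns_eq_update' α i n x 0 a, hL]⟩

theorem sGood.sub {α : A →ₗ[K] A} {m : ℕ} {F G : (ℕ → A) → A} (hF : sGood α m F)
    (hG : sGood α m G) : sGood α m (F - G) where
  loc a b h := by simp [hF.loc a b h, hG.loc a b h]
  lin i hi a := by
    obtain ⟨L, hL⟩ := hF.lin i hi a
    obtain ⟨L', hL'⟩ := hG.lin i hi a
    exact ⟨L - L', fun x => by simp [hL, hL']⟩
  compat a := by simp [hF.compat a, hG.compat a]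

theorem sGood.add {α : A →ₗ[K] A} {m : ℕ} {F G : (ℕ → A) → A} (hF : sGood α m F)
    (hG : sGood α m G) : sGood α m (F + G) where
  loc a b h := by simp [hF.loc a b h, hG.loc a b h]
  lin i hi a := by
    obtain ⟨L, hL⟩ := hF.lin i hi a
    obtain ⟨L', hL'⟩ := hG.lin i hi a
    exact ⟨L + L', fun x => by simp [hL, hL']⟩
  compat a := by simp [hF.compat a, hG.compat a]

theorem sGood.smul {α : A →ₗ[K] A} {m : ℕ} {F : (ℕ → A) → A} (hF : sGood α m F)
    (z : ℤ) : sGood α m (z • F) where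
  loc a b h := by simp [hF.loc a b h]
  lin i hi a := by
    obtain ⟨L, hL⟩ := hF.lin i hi a
    exact ⟨z • L, fun x => by simp [hL]⟩
  compat a := by simp [hF.compat a]

theorem sGood.zero {α : A →ₗ[K] A} {m : ℕ} : sGood α m (0 : (ℕ → A) → A) where
  loc a b h := rfl
  lin i hi a := ⟨0, fun x => by simp⟩
  compat a := by simp

theorem sGood.sum {α : A →ₗ[K] A} {m : ℕ} (s : Finset ℕ) (F : ℕ → (ℕ → A) → A)
    (hF : ∀ i ∈ s, sGood α m (F i)) : sGood α m (∑ i ∈ s, F i) :=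
  Finset.sum_induction F (sGood α m) (fun _ _ h h' => h.add h') sGood.zero hF

theorem sGood.sC {α : A →ₗ[K] A} {m n : ℕ} {F G : (ℕ → A) → A} (hF : sGood α m F)
    (hG : sGood α n G) {i : ℕ} (hi : i ≤ m) : sGood α (m + n) (sC α i n F G) where
  loc a b h := by
    refine hF.loc _ _ fun k hk => ?_
    have : (G fun l => a (i + l)) = G fun l => b (i + l) :=
      hG.loc _ _ fun l hl => h _ (by omega)
    simp only [sIns, this]
    split_ifs with h1 h2
    · rw [h k (by omega)]
    · rfl
    · rw [h (k + n) (by omega)]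
  lin q hq a := by
    have key : ∀ x, (∀ l, l ≤ n → i + l ≠ q) →
        (G fun l => Function.update a q x (i + l)) = G fun l => a (i + l) := by
      intro x h
      exact hG.loc _ _ fun l hl => by simp [h l hl]
    rcases lt_or_ge q i with h | h
    · obtain ⟨L, hL⟩ := hF.lin q (by omega) (sIns α i n (G fun l => a (i + l)) a)
      refine ⟨L ∘ₗ (α ^ n), fun x => ?_⟩
      rw [LinearMap.comp_apply, Module.End.pow_apply, ← hL, _root_.sC, key x (fun l _ => by omega)]
      congr 1
      funext k
      by_cases hk : k = q
      · subst hk; simp [sIns, h]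
      · by_cases hk' : k + n = q
        · have : k < i := by omega
          simp [sIns, hk, this]
        · simp [sIns, hk, hk']
    · rcases le_or_gt q (i + n) with h' | h'
      · obtain ⟨L, hL⟩ := sIns_lin hF.lin α i n hi a
        obtain ⟨L', hL'⟩ := hG.lin (q - i) (by omega) (fun l => a (i + l))
        refine ⟨L ∘ₗ L', fun x => ?_⟩
        rw [LinearMap.comp_apply, ← hL', ← hL, _root_.sC]
        have : (fun l => Function.update a q x (i + l))
            = Function.update (fun l => a (i + l)) (q - i) x := by
          funext l
          by_cases hl : l = q - i
          · subst hl
            have : i + (q - i) = q := by omega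
            simp [this]
          · have : i + l ≠ q := by omega
            simp [hl, this]
        rw [this]
        congr 1
        funext k
        simp only [sIns]
        split_ifs with h1 h2
        · rw [Function.update_of_ne (by omega)]
        · rfl
        · rw [Function.update_of_ne (by omega)]
      · obtain ⟨L, hL⟩ := hF.lin (q - n) (by omega) (sIns α i n (G fun l => a (i + l)) a)
        refine ⟨L ∘ₗ (α ^ n), fun x => ?_⟩
        rw [LinearMap.comp_apply, Module.End.pow_apply, ← hL, _root_.sC,
          key x (fun l _ => by omega)]
        congr 1
        funext k
        by_cases hk : k = q - n
        · subst hk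
          have h1 : ¬ (q - n < i) := by omega
          have h2 : ¬ (q - n = i) := by omega
          have h3 : q - n + n = q := by omega
          simp [sIns, h1, h2, h3]
        · rw [Function.update_of_ne hk]
          simp only [sIns]
          split_ifs with h1 h2
          · rw [Function.update_of_ne (by omega)]
          · rfl
          · rw [Function.update_of_ne (by omega)]
  compat a := by
    simp only [_root_.sC]
    rw [hF.compat]
    congr 1
    funext k
    simp only [sIns]
    split_ifs with h1 h2
    · rw [← Function.iterate_succ_apply' (⇑α), Function.iterate_succ_apply]
    · rw [hG.compat]
    · rw [← Function.iterate_succ_apply' (⇑α), Function.iterate_succ_apply]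

theorem sGood.sCirc {α : A →ₗ[K] A} {m n : ℕ} {F G : (ℕ → A) → A} (hF : sGood α m F)
    (hG : sGood α n G) : sGood α (m + n) (sCirc α m n F G) :=
  sGood.sum _ _ fun i hi => (hF.sC hG (by simp at hi; omega)).smul _

theorem sGood.sBr {α : A →ₗ[K] A} {m n : ℕ} {F G : (ℕ → A) → A} (hF : sGood α m F)
    (hG : sGood α n G) : sGood α (m + n) (sBr α m n F G) :=
  (hF.sCirc hG).sub ((add_comm n m ▸ hG.sCirc hF).smul _)

/-! sequential and parallel composition -/

theorem sC_seq (α : A → A) (F G H : (ℕ → A) → A) (i j n p : ℕ) (hj : j ≤ n) :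
    sC α (i + j) p (sC α i n F G) H = sC α i (n + p) F (sC α j p G H) := by
  funext a
  simp only [sC]
  congr 1
  funext k
  simp only [sIns]
  split_ifs with h1 h2 h3 h4
  all_goals try omega
  · rw [← Function.iterate_add_apply]
  · congr 1
    funext l
    simp only [sIns]
    split_ifs
    all_goals try omega
    all_goals simp only [add_assoc]
  · rw [← Function.iterate_add_apply, add_assoc]

theorem sC_par (α : A →ₗ[K] A) (F G H : (ℕ → A) → A) (i j n p : ℕ) (hij : i < j)
    (hG : sGood α n G) (hH : sGood α p H) :
    sC α (j + n) p (sC α i n F G) H = sC α i n (sC α j p F H) G := by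
  funext a
  simp only [sC]
  congr 1
  funext k
  have e1 : (G fun l => sIns α (j + n) p (H fun l => a (j + n + l)) a (i + l))
      = (⇑α)^[p] (G fun l => a (i + l)) := by
    rw [sCompat_iter hG.compat]
    refine hG.loc _ _ fun l hl => ?_
    have : i + l < j + n := by omega
    simp [sIns, this]
  have e2 : (H fun l => sIns α i n (G fun l => a (i + l)) a (j + l))
      = (⇑α)^[n] (H fun l => a (j + n + l)) := by
    rw [sCompat_iter hH.compat]
    congr 1
    funext l
    have h1 : ¬ j + l < i := by omega
    have h2 : ¬ j + l = i := by omega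
    simp only [sIns, h1, h2, if_false]
    congr 2
    omega
  rw [e1, e2]
  simp only [sIns]
  split_ifs
  all_goals try omega
  all_goals try rfl
  all_goals simp only [← Function.iterate_add_apply, add_comm n p, add_right_comm _ n p]

/-! bilinearity -/

theorem sCirc_sub_left (α : A → A) (m n : ℕ) (F F' G : (ℕ → A) → A) (z : ℤ) :
    sCirc α m n (F - z • F') G = sCirc α m n F G - z • sCirc α m n F' G := by
  funext a
  simp only [sCirc, sC, Finset.sum_apply, Pi.sub_apply, Pi.smul_apply, Finset.smul_sum, smul_sub,
    Finset.sum_sub_distrib]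
  congr 1
  exact Finset.sum_congr rfl fun i _ => smul_comm _ _ _

theorem sCirc_sub_right (α : A → A) (m n : ℕ) (F G G' : (ℕ → A) → A) (z : ℤ) (hF : sLin K m F) :
    sCirc α m n F (G - z • G') = sCirc α m n F G - z • sCirc α m n F G' := by
  funext a
  simp only [sCirc, sC, Finset.sum_apply, Pi.sub_apply, Pi.smul_apply, Finset.smul_sum]
  rw [← Finset.sum_sub_distrib]
  refine Finset.sum_congr rfl fun i hi => ?_
  obtain ⟨L, hL⟩ := sIns_lin hF α i n (by simp at hi; omega) a
  simp only [hL, map_sub, map_zsmul, smul_sub]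
  rw [smul_comm]

theorem sCirc_zero_right (α : A → A) (m n : ℕ) (F : (ℕ → A) → A) (hF : sLin K m F) :
    sCirc α m n F 0 = 0 := by
  have := sCirc_sub_right α m n F 0 0 1 hF
  simpa using this

theorem sCirc_zero_left (α : A → A) (m n : ℕ) (F : (ℕ → A) → A) :
    sCirc α m n 0 F = 0 := by
  have := sCirc_sub_left α m n 0 0 F 1
  simpa using this

theorem sCirc_smul_left (α : A → A) (m n : ℕ) (F G : (ℕ → A) → A) (z : ℤ) :
    sCirc α m n (z • F) G = z • sCirc α m n F G := by
  have := sCirc_sub_left α m n 0 F G (-z)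
  simpa [sCirc_zero_left] using this

theorem sCirc_smul_right (α : A → A) (m n : ℕ) (F G : (ℕ → A) → A) (z : ℤ) (hF : sLin K m F) :
    sCirc α m n F (z • G) = z • sCirc α m n F G := by
  have := sCirc_sub_right α m n F 0 G (-z) hF
  simpa [sCirc_zero_right α m n F hF] using this

/-- the off-diagonal part of the associator -/
def sP (α : A → A) (m n p : ℕ) (F G H : (ℕ → A) → A) : (ℕ → A) → A :=
  ∑ i ∈ Finset.range (m + 1), ∑ j ∈ Finset.Ico (i + 1) (m + 1),
    ((-1 : ℤ) ^ (n * i + p * (j + n))) • sC α (j + n) p (sC α i n F G) H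

theorem sCirc_assoc (α : A →ₗ[K] A) (m n p : ℕ) (F G H : (ℕ → A) → A)
    (hF : sGood α m F) (hG : sGood α n G) (hH : sGood α p H) :
    sCirc α (m + n) p (sCirc α m n F G) H = sCirc α m (n + p) F (sCirc α n p G H)
      + sP α m n p F G H + ((-1 : ℤ) ^ (n * p)) • sP α m p n F H G := by
  have hL : sCirc α (m + n) p (sCirc α m n F G) H
      = ∑ i ∈ Finset.range (m + 1), ∑ J ∈ Finset.range (m + n + 1),
        ((-1 : ℤ) ^ (n * i + p * J)) • sC α J p (sC α i n F G) H := by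
    rw [Finset.sum_comm]
    funext a
    simp only [sCirc, sC, Finset.sum_apply, Pi.smul_apply, Finset.smul_sum, smul_smul, pow_add]
    refine Finset.sum_congr rfl fun J _ => Finset.sum_congr rfl fun i _ => ?_
    rw [mul_comm]
  have hM : sCirc α m (n + p) F (sCirc α n p G H)
      = ∑ i ∈ Finset.range (m + 1), ∑ j ∈ Finset.range (n + 1),
        ((-1 : ℤ) ^ (n * i + p * (i + j))) • sC α (i + j) p (sC α i n F G) H := by
    rw [sCirc]
    refine Finset.sum_congr rfl fun i hi => ?_
    funext a
    obtain ⟨L, hL⟩ := sIns_lin hF.lin α i (n + p) (by simp at hi; omega) a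
    rw [Pi.smul_apply, sC, hL, sCirc, Finset.sum_apply, Finset.sum_apply, map_sum, Finset.smul_sum]
    refine Finset.sum_congr rfl fun j hj => ?_
    rw [sC_seq _ _ _ _ _ _ _ _ (by simp at hj; omega)]
    simp only [Pi.smul_apply, map_zsmul, smul_smul]
    rw [sC.eq_def α i, hL, sC.eq_def α j]
    congr 1
    ring
  have hR : ((-1 : ℤ) ^ (n * p)) • sP α m p n F H G
      = ∑ i ∈ Finset.range (m + 1), ∑ J ∈ Finset.range i,
        ((-1 : ℤ) ^ (n * i + p * J)) • sC α J p (sC α i n F G) H := by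
    rw [sP]
    simp only [Finset.smul_sum]
    rw [Finset.sum_sigma', Finset.sum_sigma']
    refine Finset.sum_bij' (fun x _ => ⟨x.2, x.1⟩) (fun x _ => ⟨x.2, x.1⟩) ?_ ?_ ?_ ?_ ?_
    · rintro ⟨i, j⟩ h; simp at h ⊢; omega
    · rintro ⟨i, j⟩ h; simp at h ⊢; omega
    · rintro ⟨i, j⟩ h; rfl
    · rintro ⟨i, j⟩ h; rfl
    · rintro ⟨i, j⟩ h
      simp at h
      simp only
      rw [sC_par α F H G i j p n (by omega) hH hG, smul_smul]
      congr 1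
      rw [← pow_add, show n * p + (p * i + n * (j + p)) = (n * j + p * i) + 2 * (n * p) by ring,
        pow_add _ _ (2 * (n * p)), pow_mul _ 2]
      simp
  rw [hL, hM, hR, sP, ← Finset.sum_add_distrib, ← Finset.sum_add_distrib]
  refine Finset.sum_congr rfl fun i hi => ?_
  have him : i ≤ m := by simp at hi; omega
  set T : ℕ → (ℕ → A) → A := fun J =>
    ((-1 : ℤ) ^ (n * i + p * J)) • sC α J p (sC α i n F G) H with hT
  change ∑ J ∈ Finset.range (m + n + 1), T J = ∑ j ∈ Finset.range (n + 1), T (i + j)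
    + ∑ j ∈ Finset.Ico (i + 1) (m + 1), T (j + n) + ∑ J ∈ Finset.range i, T J
  rw [Finset.sum_Ico_add' T (i + 1) (m + 1) n, Finset.range_eq_Ico, Finset.range_eq_Ico,
    Finset.range_eq_Ico]
  have e : ∑ j ∈ Finset.Ico 0 (n + 1), T (i + j) = ∑ j ∈ Finset.Ico i (i + 1 + n), T j := by
    rw [Finset.sum_Ico_add T 0 (n + 1) i]
    congr 2 <;> omega
  rw [e, Finset.sum_Ico_consecutive T (by omega) (by omega),
    add_comm (∑ j ∈ Finset.Ico i _, T j),
    Finset.sum_Ico_consecutive T (by omega) (by omega)]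
  congr 2
  omega

theorem sBr_jacobi (α : A →ₗ[K] A) (m n p : ℕ) (F G H : (ℕ → A) → A)
    (hF : sGood α m F) (hG : sGood α n G) (hH : sGood α p H) :
    sBr α m (n + p) F (sBr α n p G H) = sBr α (m + n) p (sBr α m n F G) H
      + ((-1 : ℤ) ^ (m * n)) • sBr α n (m + p) G (sBr α m p F H) := by
  have c1 : n + m = m + n := add_comm _ _
  have c2 : p + m = m + p := add_comm _ _
  have c3 : p + n = n + p := add_comm _ _
  have FGH := sCirc_assoc α m n p F G H hF hG hH
  have FHG := sCirc_assoc α m p n F H G hF hH hG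
  have GFH := sCirc_assoc α n m p G F H hG hF hH
  have GHF := sCirc_assoc α n p m G H F hG hH hF
  have HFG := sCirc_assoc α p m n H F G hH hF hG
  have HGF := sCirc_assoc α p n m H G F hH hG hF
  simp only [c1, c2, c3, mul_comm n m, mul_comm p m, mul_comm p n] at FGH FHG GFH GHF HFG HGF
  simp only [sBr]
  simp only [sCirc_sub_left, sCirc_sub_right (K := K) _ _ _ _ _ _ _ hF.lin,
    sCirc_sub_right (K := K) _ _ _ _ _ _ _ hG.lin,
    sCirc_sub_right (K := K) _ _ _ _ _ _ _ hH.lin, c1, c2, c3, mul_comm n m, mul_comm p m,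
    mul_comm p n, mul_add, add_mul, pow_add]
  rw [FGH, FHG, GFH, GHF, HFG, HGF]
  rcases neg_one_pow_eq_or ℤ (m * n) with h1 | h1 <;>
  rcases neg_one_pow_eq_or ℤ (m * p) with h2 | h2 <;>
  rcases neg_one_pow_eq_or ℤ (n * p) with h3 | h3 <;>
  · simp only [h1, h2, h3]
    module

/-! the differential -/

def sM (μ : A →ₗ[K] A →ₗ[K] A) : (ℕ → A) → A := fun a => μ (a 0) (a 1)

theorem sM_good (μ : A →ₗ[K] A →ₗ[K] A) (α : A →ₗ[K] A)
    (hmult : ∀ a b : A, α (μ a b) = μ (α a) (α b)) : sGood α 1 (sM μ) where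
  loc a b h := by simp [sM, h 0, h 1]
  lin i hi a := by
    interval_cases i
    · exact ⟨μ.flip (a 1), fun x => by simp [sM]⟩
    · exact ⟨μ (a 0), fun x => by simp [sM]⟩
  compat a := hmult _ _

def sD (μ : A →ₗ[K] A →ₗ[K] A) (α : A →ₗ[K] A) (n : ℕ) (F : (ℕ → A) → A) : (ℕ → A) → A :=
  ((-1 : ℤ) ^ n) • sBr α 1 n (sM μ) F

theorem sD_bracket (μ : A →ₗ[K] A →ₗ[K] A) (α : A →ₗ[K] A)
    (hmult : ∀ a b : A, α (μ a b) = μ (α a) (α b)) (m n : ℕ) (F G : (ℕ → A) → A)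
    (hF : sGood α m F) (hG : sGood α n G) :
    sD μ α (m + n) (sBr α m n F G) = ((-1 : ℤ) ^ n) • sBr α (m + 1) n (sD μ α m F) G
      + sBr α m (n + 1) F (sD μ α n G) := by
  have hM := sM_good μ α hmult
  have J := sBr_jacobi α 1 m n (sM μ) F G hM hF hG
  have e1 : sBr α (m + 1) n (sD μ α m F) G
      = ((-1 : ℤ) ^ m) • sBr α (1 + m) n (sBr α 1 m (sM μ) F) G := by
    rw [add_comm m 1, sBr, sD, sCirc_smul_left, sCirc_smul_right _ _ _ _ _ _ hG.lin, sBr.eq_def α (1 + m)]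
    rw [smul_comm, ← smul_sub]
  have e2 : sBr α m (n + 1) F (sD μ α n G)
      = ((-1 : ℤ) ^ n) • sBr α m (1 + n) F (sBr α 1 n (sM μ) G) := by
    rw [add_comm n 1, sBr, sD, sCirc_smul_left, sCirc_smul_right _ _ _ _ _ _ hF.lin, sBr.eq_def α m (1 + n)]
    rw [smul_comm, ← smul_sub]
  rw [e1, e2, sD, J, pow_add, one_mul]
  rcases neg_one_pow_eq_or ℤ m with h1 | h1 <;>
  rcases neg_one_pow_eq_or ℤ n with h2 | h2 <;>
  · simp only [h1, h2]
    module

theorem sBr_zero_left (α : A → A) (m n : ℕ) (G : (ℕ → A) → A) (hG : sLin K n G) :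
    sBr α m n 0 G = 0 := by
  rw [sBr, sCirc_zero_left, sCirc_zero_right _ _ _ _ hG]; simp

theorem sBr_zero_right (α : A → A) (m n : ℕ) (F : (ℕ → A) → A) (hF : sLin K m F) :
    sBr α m n F 0 = 0 := by
  rw [sBr, sCirc_zero_left, sCirc_zero_right _ _ _ _ hF]; simp

/-! bridge -/

def toSeq {N : ℕ} (f : (Fin N → A) → A) : (ℕ → A) → A := fun a => f fun i => a i

def sExt {N : ℕ} (a : Fin N → A) : ℕ → A := fun k => if h : k < N then a ⟨k, h⟩ else 0

theorem sExt_res {N : ℕ} (a : Fin N → A) : (fun i : Fin N => sExt a i) = a := by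
  funext i; simp [sExt]

theorem toSeq_ext {N : ℕ} (f : (Fin N → A) → A) (a : Fin N → A) : toSeq f (sExt a) = f a := by
  rw [toSeq, sExt_res]

theorem toSeq_good (α : A →ₗ[K] A) {N m : ℕ} (hN : N = m + 1)
    (f : MultilinearMap K (fun _ : Fin N => A) A)
    (hf : IsCompat (⇑α) (⇑f)) : sGood α m (toSeq f) where
  loc a b h := by
    simp only [toSeq]; congr 1; funext i; exact h _ (by omega)
  lin i hi a := by
    refine ⟨f.toLinearMap (fun j => a j) ⟨i, by omega⟩, fun x => ?_⟩
    simp only [toSeq, MultilinearMap.toLinearMap_apply]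
    congr 1
    funext j
    by_cases h : j = ⟨i, by omega⟩
    · subst h; simp
    · have : (j : ℕ) ≠ i := fun h' => h (Fin.ext h')
      simp [h, this]
  compat a := hf _

theorem sExt_update {N : ℕ} (a : Fin N → A) (i : Fin N) (x : A) :
    sExt (Function.update a i x) = Function.update (sExt a) i x := by
  funext k
  by_cases h : k = i
  · subst h; simp [sExt]
  · by_cases hk : k < N
    · have : (⟨k, hk⟩ : Fin N) ≠ i := fun h' => h (by rw [← h'])
      simp [sExt, h, hk, this]
    · simp [sExt, h, hk]

theorem exists_multilinear (α : A →ₗ[K] A) {N m : ℕ} (hN : N = m + 1) (F : (ℕ → A) → A)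
    (hF : sGood α m F) : ∃ W : MultilinearMap K (fun _ : Fin N => A) A,
      IsCompat (⇑α) (⇑W) ∧ toSeq W = F := by
  refine ⟨{ toFun := fun a => F (sExt a), map_update_add' := ?_, map_update_smul' := ?_ }, ?_, ?_⟩
  · intro inst a i x y
    rw [Subsingleton.elim inst (instDecidableEqFin N)]
    obtain ⟨L, hL⟩ := hF.lin i (by omega) (sExt a)
    simp only [sExt_update, hL, map_add]
  · intro inst a i c x
    rw [Subsingleton.elim inst (instDecidableEqFin N)]
    obtain ⟨L, hL⟩ := hF.lin i (by omega) (sExt a)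
    simp only [sExt_update, hL, map_smul]
  · intro a
    change α (F (sExt a)) = F (sExt _)
    rw [hF.compat]
    congr 1
    funext k
    simp only [sExt]
    split_ifs <;> simp
  · funext a
    change F (sExt _) = F a
    refine hF.loc _ _ fun k hk => ?_
    have : k < N := by omega
    simp [sExt, this]

theorem toSeq_vcirc (α : A → A) {m n : ℕ} (f : (Fin (m + 1) → A) → A)
    (g : (Fin (n + 1) → A) → A) : toSeq (vcirc α f g) = sCirc α m n (toSeq f) (toSeq g) := by
  funext a
  simp only [toSeq, vcirc, sCirc, Finset.sum_apply, Pi.smul_apply]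
  rw [Finset.sum_range fun i => ((-1 : ℤ) ^ (n * i)) • sC α i n (toSeq f) (toSeq g) a]
  rfl

theorem toSeq_vbracket (α : A → A) {m n : ℕ} (f : (Fin (m + 1) → A) → A)
    (g : (Fin (n + 1) → A) → A) : toSeq (vbracket α f g) = sBr α m n (toSeq f) (toSeq g) := by
  rw [sBr, ← toSeq_vcirc, ← toSeq_vcirc]
  rfl

theorem toSeq_homDelta (μ : A →ₗ[K] A →ₗ[K] A) (α : A →ₗ[K] A) {N m : ℕ} (hN : N = m + 1)
    (f : (Fin N → A) → A) :
    toSeq (homDelta (fun x y => μ x y) (⇑α) N f) = sD μ α m (toSeq f) := by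
  subst hN
  funext a
  have h1 : sCirc α 1 m (sM μ) (toSeq f) a = μ (toSeq f a) ((⇑α)^[m] (a (1 + m)))
      + ((-1 : ℤ) ^ m) • μ ((⇑α)^[m] (a 0)) (toSeq f fun l => a (1 + l)) := by
    simp [sCirc, Finset.sum_range_succ, sC, sM, sIns]
  have h2 : sCirc α m 1 (toSeq f) (sM μ) a = ∑ i : Fin (m + 1), ((-1 : ℤ) ^ (i : ℕ)) •
        f (fun j => if (j : ℕ) < (i : ℕ) then α (a j)
          else if (j : ℕ) = (i : ℕ) then μ (a j) (a (j + 1))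
          else α (a (j + 1))) := by
    simp only [sCirc, Finset.sum_apply, Pi.smul_apply, one_mul]
    rw [Finset.sum_range fun i => ((-1 : ℤ) ^ i) • sC α i 1 (toSeq f) (sM μ) a]
    refine Finset.sum_congr rfl fun i _ => ?_
    congr 1
    simp only [sC, toSeq]
    congr 1
    funext j
    simp only [sIns, sM]
    split_ifs with h h'
    · rfl
    · rw [h']; rfl
    · rfl
  rw [sD, Pi.smul_apply, sBr, Pi.sub_apply, Pi.smul_apply, h1, h2]
  simp only [toSeq, homDelta, Fin.val_succ, Fin.val_castSucc, Fin.val_last, Fin.val_zero,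
    Nat.add_sub_cancel, one_mul, pow_succ, mul_neg, mul_one, neg_neg, neg_smul,
    Finset.sum_neg_distrib, add_comm 1]
  rcases neg_one_pow_eq_or ℤ m with h | h <;>
  · simp only [h]
    module

theorem toSeq_eq_zero {N : ℕ} {f : (Fin N → A) → A} (h : ∀ a, f a = 0) : toSeq f = 0 := by
  funext a; exact h _

end Seq

/-- In a multiplicative hom-associative algebra, the bracket of two cocycles is a
cocycle, and the bracket of a cocycle with a coboundary (on either side) is a
coboundary; hence `[-,-]_α` descends to a degree `-1` graded Lie bracket on
cohomology. Here `f ∈ C^{m+1}_α`, `g ∈ C^{n+1}_α` with `m, n ≥ 1`. -/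
theorem bracket_descends_to_cohomology
    {K : Type*} [Field K] [CharZero K] {A : Type*} [AddCommGroup A] [Module K A]
    (μ : A →ₗ[K] A →ₗ[K] A) (α : A →ₗ[K] A)
    (hassoc : ∀ a b c : A, μ (α a) (μ b c) = μ (μ a b) (α c))
    (hmult : ∀ a b : A, α (μ a b) = μ (α a) (α b))
    (m n : ℕ) (hm : 1 ≤ m) (hn : 1 ≤ n)
    (f : MultilinearMap K (fun _ : Fin (m + 1) => A) A)
    (g : MultilinearMap K (fun _ : Fin (n + 1) => A) A)
    (hf : IsCompat (⇑α) (⇑f)) (hg : IsCompat (⇑α) (⇑g)) :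
    -- bracket of cocycles is a cocycle
    ((∀ a, homDelta (fun x y => μ x y) (⇑α) (m + 1) (⇑f) a = 0) →
     (∀ a, homDelta (fun x y => μ x y) (⇑α) (n + 1) (⇑g) a = 0) →
     ∀ a, homDelta (fun x y => μ x y) (⇑α) (m + n + 1) (vbracket (⇑α) (⇑f) (⇑g)) a = 0) ∧
    -- coboundary bracket cocycle is a coboundary
    ((∃ f' : MultilinearMap K (fun _ : Fin m => A) A, IsCompat (⇑α) (⇑f') ∧
        ∀ a, homDelta (fun x y => μ x y) (⇑α) m (⇑f') a = f a) →
     (∀ a, homDelta (fun x y => μ x y) (⇑α) (n + 1) (⇑g) a = 0) →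
     ∃ W : MultilinearMap K (fun _ : Fin (m + n) => A) A, IsCompat (⇑α) (⇑W) ∧
        ∀ a, homDelta (fun x y => μ x y) (⇑α) (m + n) (⇑W) a
          = vbracket (⇑α) (⇑f) (⇑g) a) ∧
    -- cocycle bracket coboundary is a coboundary
    ((∀ a, homDelta (fun x y => μ x y) (⇑α) (m + 1) (⇑f) a = 0) →
     (∃ g' : MultilinearMap K (fun _ : Fin n => A) A, IsCompat (⇑α) (⇑g') ∧
        ∀ a, homDelta (fun x y => μ x y) (⇑α) n (⇑g') a = g a) →
     ∃ W : MultilinearMap K (fun _ : Fin (m + n) => A) A, IsCompat (⇑α) (⇑W) ∧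
        ∀ a, homDelta (fun x y => μ x y) (⇑α) (m + n) (⇑W) a
          = vbracket (⇑α) (⇑f) (⇑g) a) := by
  refine ⟨fun h1 h2 a => ?_, ?_, ?_⟩
  · have hF := toSeq_good α rfl f hf
    have hG := toSeq_good α rfl g hg
    have d1 := toSeq_eq_zero h1
    have d2 := toSeq_eq_zero h2
    rw [toSeq_homDelta μ α rfl] at d1 d2
    rw [← toSeq_ext (homDelta _ _ _ _), toSeq_homDelta μ α rfl, toSeq_vbracket,
      sD_bracket μ α hmult m n _ _ hF hG, d1, d2, sBr_zero_left _ _ _ _ hG.lin,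
      sBr_zero_right _ _ _ _ hF.lin]
    simp
  · rintro ⟨f', hf', e⟩ h2
    obtain ⟨m, rfl⟩ : ∃ k, m = k + 1 := ⟨m - 1, by omega⟩
    have hF := toSeq_good α rfl f' hf'
    have hG := toSeq_good α rfl g hg
    have d2 := toSeq_eq_zero h2
    have d1 := congrArg toSeq (funext e)
    rw [toSeq_homDelta μ α rfl] at d1 d2
    have hB := hF.sBr hG
    obtain ⟨W, hW, eW⟩ := exists_multilinear α (N := m + 1 + n) (m := m + n) (by omega) _
      (hB.smul ((-1 : ℤ) ^ n))
    refine ⟨W, hW, fun a => ?_⟩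
    rw [← toSeq_ext (homDelta _ _ _ _), toSeq_homDelta μ α (m := m + n) (by omega), eW,
      ← toSeq_ext (vbracket _ _ _), toSeq_vbracket]
    have e3 := sD_bracket μ α hmult m n _ _ hF hG
    rw [d1, d2, sBr_zero_right _ _ _ _ hF.lin, add_zero] at e3
    have e4 : sD μ α (m + n) (((-1 : ℤ) ^ n) • sBr α m n (toSeq f') (toSeq g))
        = ((-1 : ℤ) ^ n) • sD μ α (m + n) (sBr α m n (toSeq f') (toSeq g)) := by
      rw [sD, sBr, sCirc_smul_left, sCirc_smul_right _ _ _ _ _ _ (sM_good μ α hmult).lin, sD]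
      conv_rhs => rw [sBr]
      module
    rw [e4, e3, smul_smul, ← mul_pow]
    simp
  · rintro h1 ⟨g', hg', e⟩
    obtain ⟨n, rfl⟩ : ∃ k, n = k + 1 := ⟨n - 1, by omega⟩
    have hF := toSeq_good α rfl f hf
    have hG := toSeq_good α rfl g' hg'
    have d1 := toSeq_eq_zero h1
    have d2 := congrArg toSeq (funext e)
    rw [toSeq_homDelta μ α rfl] at d1 d2
    have hB := hF.sBr hG
    obtain ⟨W, hW, eW⟩ := exists_multilinear α (N := m + (n + 1)) (m := m + n) (by omega) _ hB
    refine ⟨W, hW, fun a => ?_⟩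
    rw [← toSeq_ext (homDelta _ _ _ _), toSeq_homDelta μ α (m := m + n) (by omega), eW,
      ← toSeq_ext (vbracket _ _ _), toSeq_vbracket,
      sD_bracket μ α hmult m n _ _ hF hG, d1, d2, sBr_zero_left _ _ _ _ hG.lin, smul_zero, zero_add]
end

section
/- In a multiplicative hom-associative algebra, for f ∈ C^m_α(A,A) and g ∈ Cⁿ_α(A,A): f ∘ δ_α g - δ_α(f ∘ g) + (-1)^{n-1} (δ_α f) ∘ g = (-1)^{n-1} ( g ∪_α f - (-1)^{mn} f ∪_α g ). In particular, if f and g are cocycles, then g ∪_α f - (-1)^{mn} f ∪_α g = (-1)^n δ_α(f ∘ g), so the cup product is graded commutative on cohomology. -/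
/-- sequence version of insertion -/
def seqP {A : Type*} (α : A → A) (i s : ℕ) (x : A) (b : ℕ → A) : ℕ → A := fun k =>
  if k < i then α^[s] (b k) else if k = i then x else α^[s] (b (k + s))

/-- sequence version of the inner multiplication -/
def seqQ {A : Type*} (μ : A → A → A) (α : A → A) (j : ℕ) (b : ℕ → A) : ℕ → A := fun k =>
  if k < j then α (b k) else if k = j then μ (b k) (b (k + 1)) else α (b (k + 1))

/-- shift -/
def seqS {A : Type*} (i : ℕ) (b : ℕ → A) : ℕ → A := fun k => b (i + k)

/-- sequence version of a cochain -/
def seqF {A : Type*} {m : ℕ} (f : (Fin m → A) → A) (b : ℕ → A) : A := f fun k => b k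

theorem seqF_congr {A : Type*} {m : ℕ} (f : (Fin m → A) → A) (b c : ℕ → A)
    (h : ∀ k < m, b k = c k) : seqF f b = seqF f c := by
  unfold seqF
  congr 1
  funext k
  exact h k k.2

theorem seq_delta {A : Type*} [AddCommGroup A] (μ : A → A → A) (α : A → A) (n : ℕ)
    (f : (Fin (n + 1) → A) → A) (b : ℕ → A) :
    homDelta μ α (n + 1) f (fun k => b k) =
      μ (α^[n] (b 0)) (seqF f (seqS 1 b))
      + ∑ i ∈ Finset.range (n + 1), ((-1 : ℤ) ^ (i + 1)) • seqF f (seqQ μ α i b)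
      + ((-1 : ℤ) ^ n) • μ (seqF f b) (α^[n] (b (n + 1))) := by
  rw [← Fin.sum_univ_eq_sum_range
    (fun i => ((-1 : ℤ) ^ (i + 1)) • seqF f (seqQ μ α i b)) (n + 1)]
  have h : seqF f (seqS 1 b) = f (fun i => b (i.succ : Fin (n + 2))) := by
    unfold seqF seqS
    congr 1
    funext k
    simp [add_comm]
  rw [h, show ((-1 : ℤ) ^ n) = (-1) ^ (n + 1 + 1) by ring]
  rfl

theorem seq_circ {A : Type*} [AddCommGroup A] (α : A → A) {m n : ℕ}
    (f : (Fin (m + 1) → A) → A) (g : (Fin (n + 1) → A) → A) (b : ℕ → A) :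
    vcirc α f g (fun k => b k) =
      ∑ i ∈ Finset.range (m + 1), ((-1 : ℤ) ^ (n * i)) •
        seqF f (seqP α i n (seqF g (seqS i b)) b) := by
  rw [← Fin.sum_univ_eq_sum_range
    (fun i => ((-1 : ℤ) ^ (n * i)) • seqF f (seqP α i n (seqF g (seqS i b)) b)) (m + 1)]
  rfl

theorem sum_v {A : Type*} [AddCommGroup A] (v : ℕ → A) (j M : ℕ) (h : j + 1 ≤ M) :
    ∑ i ∈ Finset.range (M + 1), v i =
      ∑ i ∈ Finset.range M, ((if i ≤ j then v i else 0) + if j ≤ i then v (i + 1) else 0) := by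
  induction M, h using Nat.le_induction with
  | base =>
    rw [Finset.sum_range_succ, Finset.sum_range_succ, Finset.sum_range_succ]
    rw [Finset.sum_congr (s₁ := Finset.range j) (g := v)
      (f := fun i => (if i ≤ j then v i else 0) + if j ≤ i then v (i + 1) else 0) rfl]
    · simp [add_assoc]
    · intro x hx
      have := Finset.mem_range.1 hx
      simp [this.le, this.not_ge]
  | succ M h ih =>
    rw [Finset.sum_range_succ, ih, Finset.sum_range_succ _ M]
    simp [show ¬ M ≤ j by omega, show j ≤ M by omega]

theorem sum_w {A : Type*} [AddCommGroup A] (w : ℕ → A) (n i m : ℕ) (h : i ≤ m) :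
    ∑ k ∈ Finset.range (m + n + 1), w k =
      ∑ k ∈ Finset.range (m + 1), ((if k < i then w k else 0) + if i < k then w (k + n) else 0)
      + ∑ j ∈ Finset.range (n + 1), w (i + j) := by
  induction m, h using Nat.le_induction with
  | base =>
    rw [add_assoc, Finset.sum_range_add, Finset.sum_range_succ _ i]
    rw [Finset.sum_congr (s₁ := Finset.range i) (g := w)
      (f := fun k => (if k < i then w k else 0) + if i < k then w (k + n) else 0) rfl]
    · simp
    · intro x hx
      have := Finset.mem_range.1 hx
      simp [this, this.le]
  | succ M h ih =>
    rw [show M + 1 + n + 1 = (M + n + 1) + 1 by ring, Finset.sum_range_succ, ih,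
      Finset.sum_range_succ _ (M + 1)]
    simp [show ¬ M + 1 < i by omega, show i < M + 1 by omega, show M + n + 1 = M + 1 + n by ring]
    abel

theorem sum_main {A : Type*} [AddCommGroup A] (m n : ℕ) (X Z : ℕ → A) (Y W V : ℕ → ℕ → A)
    (hY : ∀ i j, j ≤ n → W (i + j) i = Y i j)
    (hX : ∀ i, V (i + 1) i = X i) (hZ : ∀ i, V i i = Z i)
    (h1 : ∀ i j, j < i → V (i + 1) j = W j i)
    (h2 : ∀ i j, i < j → V i j = W (j + n) i) :
    ∑ i ∈ Finset.range (m + 1), ((-1 : ℤ) ^ ((n + 1) * i)) •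
        (X i + ∑ j ∈ Finset.range (n + 1), ((-1 : ℤ) ^ (j + 1)) • Y i j + ((-1 : ℤ) ^ n) • Z i)
    - ∑ k ∈ Finset.range (m + n + 1), ((-1 : ℤ) ^ (k + 1)) •
        ∑ i ∈ Finset.range (m + 1), ((-1 : ℤ) ^ (n * i)) • W k i
    + ((-1 : ℤ) ^ n) • ∑ i ∈ Finset.range (m + 1 + 1), ((-1 : ℤ) ^ (n * i)) •
        ∑ j ∈ Finset.range (m + 1), ((-1 : ℤ) ^ (j + 1)) • V i j = 0 := by
  simp only [Finset.smul_sum]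
  rw [Finset.sum_comm (s := Finset.range (m + n + 1)),
    Finset.sum_comm (s := Finset.range (m + 1 + 1))]
  have e3 : ∀ j ∈ Finset.range (m + 1), ∑ i ∈ Finset.range (m + 1 + 1),
      ((-1 : ℤ) ^ n) • ((-1 : ℤ) ^ (n * i)) • ((-1 : ℤ) ^ (j + 1)) • V i j = _ :=
    fun j hj => sum_v _ j (m + 1) (Finset.mem_range.1 hj)
  rw [Finset.sum_congr rfl e3, Finset.sum_comm (s := Finset.range (m + 1)) (t := Finset.range (m + 1)),
    ← Finset.sum_sub_distrib, ← Finset.sum_add_distrib]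
  refine Finset.sum_eq_zero fun i hi => ?_
  rw [sum_w _ n i m (Nat.lt_succ_iff.1 (Finset.mem_range.1 hi))]
  have e1 : ∀ j ∈ Finset.range (n + 1), ((-1 : ℤ) ^ (i + j + 1)) • ((-1 : ℤ) ^ (n * i)) • W (i + j) i
      = ((-1 : ℤ) ^ ((n + 1) * i)) • ((-1 : ℤ) ^ (j + 1)) • Y i j := by
    intro j hj
    rw [hY i j (Nat.lt_succ_iff.1 (Finset.mem_range.1 hj)), smul_smul, smul_smul]
    congr 1
    ring
  rw [Finset.sum_congr rfl e1]
  have e2 : ∀ j ∈ Finset.range (m + 1),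
      ((if i ≤ j then ((-1 : ℤ) ^ n) • ((-1 : ℤ) ^ (n * i)) • ((-1 : ℤ) ^ (j + 1)) • V i j else 0) +
        if j ≤ i then ((-1 : ℤ) ^ n) • ((-1 : ℤ) ^ (n * (i + 1))) • ((-1 : ℤ) ^ (j + 1)) • V (i + 1) j
          else 0)
      = ((if j < i then ((-1 : ℤ) ^ (j + 1)) • ((-1 : ℤ) ^ (n * i)) • W j i else 0) +
        if i < j then ((-1 : ℤ) ^ (j + n + 1)) • ((-1 : ℤ) ^ (n * i)) • W (j + n) i else 0) +
        if i = j then -(((-1 : ℤ) ^ ((n + 1) * i)) • (X i + ((-1 : ℤ) ^ n) • Z i)) else 0 := by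
    intro j _
    have hn : ((-1 : ℤ) ^ n) * (-1) ^ n = 1 := by
      rw [← mul_pow]; simp
    rcases lt_trichotomy i j with h | h | h
    · simp only [h, h.le, h.not_ge, h.not_gt, h.ne, if_true, if_false, h2 i j h, smul_smul,
        add_zero, zero_add]
      congr 1
      ring
    · subst h
      simp only [le_refl, lt_irrefl, if_true, if_false, hX, hZ, smul_smul, zero_add, smul_add,
        neg_add_rev, ← neg_smul]
      congr 2
      · ring
      · linear_combination (((-1 : ℤ) ^ (n * i)) * (-1) ^ (i + 1)) * hn
    · simp only [h, h.le, h.not_ge, h.not_gt, h.ne', if_true, if_false, h1 i j h, smul_smul,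
        add_zero, zero_add]
      congr 1
      linear_combination (((-1 : ℤ) ^ (n * i)) * (-1) ^ (j + 1)) * hn
  rw [Finset.sum_congr rfl e2, Finset.sum_add_distrib (s := Finset.range (m + 1)) (g := fun j => if i = j then _ else _),
    Finset.sum_ite_eq, if_pos hi]
  simp only [smul_add, Finset.smul_sum]
  abel


theorem seqF_lin {K : Type*} [Field K] {A : Type*} [AddCommGroup A] [Module K A] (α : A → A)
    {m : ℕ} (f : MultilinearMap K (fun _ : Fin (m + 1) => A) A) (i s : ℕ) (hi : i < m + 1)
    (x : A) (b : ℕ → A) :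
    seqF f (seqP α i s x b) =
      f.toLinearMap (fun k : Fin (m + 1) => seqP α i s 0 b k) ⟨i, hi⟩ x := by
  rw [MultilinearMap.toLinearMap_apply]
  unfold seqF
  congr 1
  funext k
  by_cases h : k = ⟨i, hi⟩
  · subst h
    simp [seqP]
  · rw [Function.update_of_ne h]
    have : (k : ℕ) ≠ i := fun h' => h (Fin.ext h')
    simp [seqP, this]

set_option maxHeartbeats 2000000 in
theorem seq_identity
    {K : Type*} [Field K] {A : Type*} [AddCommGroup A] [Module K A]
    (μ : A →ₗ[K] A →ₗ[K] A) (α : A →ₗ[K] A)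
    (hmult : ∀ a b : A, α (μ a b) = μ (α a) (α b))
    (m n : ℕ)
    (f : MultilinearMap K (fun _ : Fin (m + 1) => A) A)
    (g : MultilinearMap K (fun _ : Fin (n + 1) => A) A)
    (hf : IsCompat (⇑α) (⇑f)) (hg : IsCompat (⇑α) (⇑g)) (b : ℕ → A) :
      vcirc (⇑α) (⇑f) (homDelta (fun x y => μ x y) (⇑α) (n + 1) (⇑g)) (fun k => b k)
          - homDelta (fun x y => μ x y) (⇑α) (m + n + 1) (vcirc (⇑α) (⇑f) (⇑g)) (fun k => b k)
          + ((-1 : ℤ) ^ n) •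
              vcirc (⇑α) (homDelta (fun x y => μ x y) (⇑α) (m + 1) (⇑f)) (⇑g) (fun k => b k)
        = ((-1 : ℤ) ^ n) •
            (cupProd (fun x y => μ x y) (⇑α) (⇑g) (⇑f) (fun k => b k)
              - ((-1 : ℤ) ^ ((m + 1) * (n + 1))) •
                  cupProd (fun x y => μ x y) (⇑α) (⇑f) (⇑g) (fun k => b k)) := by
  have hfs : ∀ (s : ℕ) (c : ℕ → A), α^[s] (seqF f c) = seqF f (fun k => α^[s] (c k)) := by
    intro s
    induction s with
    | zero => intro c; rfl
    | succ s ih =>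
      intro c
      simp only [Function.iterate_succ_apply', ih]
      exact hf _
  have hg1 : ∀ (c : ℕ → A), α (seqF g c) = seqF g (fun k => α (c k)) := fun c => hg _
  have hμs : ∀ (s : ℕ) (x y : A), α^[s] (μ x y) = μ (α^[s] x) (α^[s] y) := by
    intro s
    induction s with
    | zero => intro x y; rfl
    | succ s ih =>
      intro x y
      simp only [Function.iterate_succ_apply', ih, hmult]
  have hδg : ∀ c : ℕ → A, seqF (homDelta (fun x y => μ x y) (⇑α) (n + 1) (⇑g)) c = _ :=
    fun c => seq_delta _ _ n _ c
  have hδf : ∀ c : ℕ → A, seqF (homDelta (fun x y => μ x y) (⇑α) (m + 1) (⇑f)) c = _ :=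
    fun c => seq_delta _ _ m _ c
  have hfg : ∀ c : ℕ → A, seqF (vcirc (⇑α) (⇑f) (⇑g)) c = _ :=
    fun c => seq_circ _ _ _ c
  have hgf' : cupProd (fun x y => μ x y) (⇑α) (⇑g) (⇑f) (fun k => b k)
      = μ (α^[m] (seqF g b)) (α^[n] (seqF f (seqS (n + 1) b))) := rfl
  have hfg' : cupProd (fun x y => μ x y) (⇑α) (⇑f) (⇑g) (fun k => b k)
      = μ (α^[n] (seqF f b)) (α^[m] (seqF g (seqS (m + 1) b))) := rfl
  rw [hgf', hfg', seq_circ, seq_delta, seq_circ]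
  simp only [hδg, hδf, hfg]
  set X : ℕ → A := fun i =>
    seqF f (seqP α i (n + 1) (μ (α^[n] (b i)) (seqF g (seqS (i + 1) b))) b) with hXdef
  set Z : ℕ → A := fun i =>
    seqF f (seqP α i (n + 1) (μ (seqF g (seqS i b)) (α^[n] (b (i + (n + 1))))) b) with hZdef
  set Y : ℕ → ℕ → A := fun i j =>
    seqF f (seqP α i (n + 1) (seqF g (seqQ (fun x y => μ x y) α j (seqS i b))) b) with hYdef
  set W : ℕ → ℕ → A := fun k i =>
    seqF f (seqP α i n (seqF g (seqS i (seqQ (fun x y => μ x y) α k b)))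
      (seqQ (fun x y => μ x y) α k b)) with hWdef
  set V : ℕ → ℕ → A := fun i j =>
    seqF f (seqQ (fun x y => μ x y) α j (seqP α i n (seqF g (seqS i b)) b)) with hVdef
  have key := sum_main m n X Z Y W V ?_ ?_ ?_ ?_ ?_
  · have t1 : ∀ i ∈ Finset.range (m + 1), ((-1 : ℤ) ^ ((n + 1) * i)) •
        seqF f (seqP α i (n + 1) (μ (α^[n] (seqS i b 0)) (seqF g (seqS 1 (seqS i b)))
          + ∑ j ∈ Finset.range (n + 1), ((-1 : ℤ) ^ (j + 1)) •
              seqF g (seqQ (fun x y => μ x y) α j (seqS i b))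
          + ((-1 : ℤ) ^ n) • μ (seqF g (seqS i b)) (α^[n] (seqS i b (n + 1)))) b)
        = ((-1 : ℤ) ^ ((n + 1) * i)) •
        (X i + ∑ j ∈ Finset.range (n + 1), ((-1 : ℤ) ^ (j + 1)) • Y i j
          + ((-1 : ℤ) ^ n) • Z i) := by
      intro i hi
      have hi' := Finset.mem_range.1 hi
      have e : seqS 1 (seqS i b) = seqS (i + 1) b := by
        funext k
        simp only [seqS, add_assoc]
      simp only [hXdef, hYdef, hZdef, seqF_lin _ f i _ hi', map_add, map_sum, map_zsmul, e]
      rfl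
    rw [Finset.sum_congr rfl t1]
    simp only [smul_add, Finset.sum_add_distrib] at key ⊢
    -- the outer terms
    have L : ∑ i ∈ Finset.range (m + 1 + 1), ((-1 : ℤ) ^ (n * i)) •
          μ (α^[m] (seqP α i n (seqF g (seqS i b)) b 0))
            (seqF f (seqS 1 (seqP α i n (seqF g (seqS i b)) b)))
        = μ (α^[m] (seqF g b)) (α^[n] (seqF f (seqS (n + 1) b)))
          + ((-1 : ℤ) ^ n) • μ (α^[m + n] (b 0)) (∑ i ∈ Finset.range (m + 1), ((-1 : ℤ) ^ (n * i)) •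
            seqF f (seqP α i n (seqF g (seqS i (seqS 1 b))) (seqS 1 b))) := by
      rw [Finset.sum_range_succ', add_comm]
      congr 1
      · have e0 : seqS 0 b = b := by funext k; simp [seqS]
        rw [hfs, e0]
        simp only [mul_zero, pow_zero, one_smul]
        congr 2
        funext k
        simp [seqS, seqP, add_comm, add_left_comm]
      · rw [map_sum, Finset.smul_sum]
        refine Finset.sum_congr rfl fun i _ => ?_
        rw [map_zsmul, smul_smul]
        congr 1
        · ring
        · congr 2
          · simp [seqP, Function.iterate_add_apply]
          · congr 1
            have e : seqS i (seqS 1 b) = seqS (i + 1) b := by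
              funext k
              simp only [seqS]
              congr 1
              omega
            rw [e]
            funext k
            simp only [seqS, seqP]
            split_ifs <;> first | rfl | omega | (congr 2; omega)
    have R : ∑ i ∈ Finset.range (m + 1 + 1), ((-1 : ℤ) ^ (n * i)) •
          ((-1 : ℤ) ^ m) • μ (seqF f (seqP α i n (seqF g (seqS i b)) b))
            (α^[m] (seqP α i n (seqF g (seqS i b)) b (m + 1)))
        = ((-1 : ℤ) ^ (n * (m + 1) + m)) •
            μ (α^[n] (seqF f b)) (α^[m] (seqF g (seqS (m + 1) b)))
          + ((-1 : ℤ) ^ m) • μ (∑ i ∈ Finset.range (m + 1), ((-1 : ℤ) ^ (n * i)) •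
            seqF f (seqP α i n (seqF g (seqS i b)) b)) (α^[m + n] (b (m + n + 1))) := by
      rw [Finset.sum_range_succ, add_comm]
      congr 1
      · rw [hfs, smul_smul, ← pow_add]
        congr 3
        · apply seqF_congr
          intro k hk
          simp [seqP, hk]
        · simp [seqP]
      · rw [map_sum, LinearMap.sum_apply, Finset.smul_sum]
        refine Finset.sum_congr rfl fun i hi => ?_
        have hi' := Finset.mem_range.1 hi
        rw [map_zsmul, LinearMap.smul_apply, smul_comm]
        rw [Function.iterate_add_apply]
        simp only [seqP, if_neg hi'.not_gt, if_neg hi'.ne']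
        rw [show m + 1 + n = m + n + 1 by omega]
    rw [L, R]
    have hn : ((-1 : ℤ) ^ n) * (-1) ^ n = 1 := by
      rw [← mul_pow]; simp
    have s1 : ((-1 : ℤ) ^ (n * (m + 1) + m)) = - (-1) ^ ((m + 1) * (n + 1)) := by ring
    simp only [smul_add, smul_sub, smul_smul, hn, one_smul, s1, neg_smul, smul_neg, hWdef, hVdef,
      show ((-1 : ℤ) ^ (m + n)) = (-1) ^ n * (-1) ^ m by ring] at key ⊢
    rw [← sub_eq_zero]
    rw [← key]
    abel
  · intro i j hj
    simp only [hWdef, hYdef]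
    have e : seqS i (seqQ (fun x y => μ x y) α (i + j) b)
        = seqQ (fun x y => μ x y) α j (seqS i b) := by
      funext k
      simp only [seqS, seqQ]
      split_ifs <;> first | rfl | omega
    rw [e]
    congr 1
    funext k
    simp only [seqP, seqQ]
    split_ifs <;> first | rfl | omega
  · intro i
    simp only [hXdef, hVdef]
    congr 1
    funext k
    rcases lt_trichotomy k i with h | h | h
    · simp [seqP, seqQ, h, Nat.lt_succ_of_lt h, Function.iterate_succ_apply']
    · subst h
      simp [seqP, seqQ]
    · simp [seqP, seqQ, h.not_gt, h.ne', Function.iterate_succ_apply',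
        show ¬ k < i by omega, show ¬ k = i by omega]
      congr 3
      omega
  · intro i
    simp only [hZdef, hVdef]
    congr 1
    funext k
    rcases lt_trichotomy k i with h | h | h
    · simp [seqP, seqQ, h, Function.iterate_succ_apply']
    · subst h
      simp [seqP, seqQ]
      congr 3
      omega
    · simp [seqP, seqQ, Function.iterate_succ_apply',
        show ¬ k < i by omega, show ¬ k = i by omega, show ¬ k + 1 < i by omega,
        show ¬ k + 1 = i by omega]
      congr 3
      omega
  · intro i j hj
    simp only [hWdef, hVdef]
    congr 1
    have e : α (seqF g (seqS (i + 1) b))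
        = seqF g (seqS i (seqQ (fun x y => μ x y) α j b)) := by
      rw [hg1]
      congr 1
      funext k
      simp only [seqS, seqQ, show ¬ i + k < j by omega, show ¬ i + k = j by omega, if_false]
      congr 2
      omega
    rw [← e]
    funext k
    simp only [seqP, seqQ]
    split_ifs <;> first
      | rfl
      | omega
      | (rw [← Function.iterate_succ_apply' (⇑α), Function.iterate_succ_apply]; done)
      | (rw [hμs]; done)
      | (rw [← Function.iterate_succ_apply' (⇑α), Function.iterate_succ_apply]; congr 3; omega)
  · intro i j hj
    simp only [hWdef, hVdef]
    congr 1
    have e : α (seqF g (seqS i b))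
        = seqF g (seqS i (seqQ (fun x y => μ x y) α (j + n) b)) := by
      rw [hg1]
      apply seqF_congr
      intro k hk
      simp only [seqS, seqQ, show i + k < j + n by omega, if_true]
    rw [← e]
    funext k
    simp only [seqP, seqQ]
    split_ifs <;> first
      | rfl
      | omega
      | (rw [← Function.iterate_succ_apply' (⇑α), Function.iterate_succ_apply]; done)
      | (rw [hμs]; congr 3; omega)
      | (rw [← Function.iterate_succ_apply' (⇑α), Function.iterate_succ_apply]; congr 3; omega)

/-- In a multiplicative hom-associative algebra, for `f ∈ C^{m+1}_α`, `g ∈ C^{n+1}_α`: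
`f ∘ δ_α g - δ_α(f ∘ g) + (-1)^n (δ_α f) ∘ g = (-1)^n (g ∪_α f - (-1)^{(m+1)(n+1)} f ∪_α g)`.
In particular, if `f` and `g` are cocycles then
`g ∪_α f - (-1)^{(m+1)(n+1)} f ∪_α g = (-1)^{n+1} δ_α(f ∘ g)`, so the cup product is
graded commutative on cohomology. -/
theorem cupProd_graded_comm_up_to_coboundary
    {K : Type*} [Field K] [CharZero K] {A : Type*} [AddCommGroup A] [Module K A]
    (μ : A →ₗ[K] A →ₗ[K] A) (α : A →ₗ[K] A)
    (hassoc : ∀ a b c : A, μ (α a) (μ b c) = μ (μ a b) (α c))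
    (hmult : ∀ a b : A, α (μ a b) = μ (α a) (α b))
    (m n : ℕ)
    (f : MultilinearMap K (fun _ : Fin (m + 1) => A) A)
    (g : MultilinearMap K (fun _ : Fin (n + 1) => A) A)
    (hf : IsCompat (⇑α) (⇑f)) (hg : IsCompat (⇑α) (⇑g)) :
    (∀ a : Fin (m + n + 2) → A,
      vcirc (⇑α) (⇑f) (homDelta (fun x y => μ x y) (⇑α) (n + 1) (⇑g)) a
          - homDelta (fun x y => μ x y) (⇑α) (m + n + 1) (vcirc (⇑α) (⇑f) (⇑g)) a
          + ((-1 : ℤ) ^ n) •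
              vcirc (⇑α) (homDelta (fun x y => μ x y) (⇑α) (m + 1) (⇑f)) (⇑g)
                (reindex (by omega) a)
        = ((-1 : ℤ) ^ n) •
            (cupProd (fun x y => μ x y) (⇑α) (⇑g) (⇑f) (reindex (by omega) a)
              - ((-1 : ℤ) ^ ((m + 1) * (n + 1))) •
                  cupProd (fun x y => μ x y) (⇑α) (⇑f) (⇑g) a)) ∧
    ((∀ a, homDelta (fun x y => μ x y) (⇑α) (m + 1) (⇑f) a = 0) →
     (∀ a, homDelta (fun x y => μ x y) (⇑α) (n + 1) (⇑g) a = 0) →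
     ∀ a : Fin (m + n + 2) → A,
       cupProd (fun x y => μ x y) (⇑α) (⇑g) (⇑f) (reindex (by omega) a)
           - ((-1 : ℤ) ^ ((m + 1) * (n + 1))) •
               cupProd (fun x y => μ x y) (⇑α) (⇑f) (⇑g) a
         = ((-1 : ℤ) ^ (n + 1)) •
             homDelta (fun x y => μ x y) (⇑α) (m + n + 1) (vcirc (⇑α) (⇑f) (⇑g)) a) := by
  have main : ∀ a : Fin (m + n + 2) → A,
      vcirc (⇑α) (⇑f) (homDelta (fun x y => μ x y) (⇑α) (n + 1) (⇑g)) a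
          - homDelta (fun x y => μ x y) (⇑α) (m + n + 1) (vcirc (⇑α) (⇑f) (⇑g)) a
          + ((-1 : ℤ) ^ n) •
              vcirc (⇑α) (homDelta (fun x y => μ x y) (⇑α) (m + 1) (⇑f)) (⇑g)
                (reindex (by omega) a)
        = ((-1 : ℤ) ^ n) •
            (cupProd (fun x y => μ x y) (⇑α) (⇑g) (⇑f) (reindex (by omega) a)
              - ((-1 : ℤ) ^ ((m + 1) * (n + 1))) •
                  cupProd (fun x y => μ x y) (⇑α) (⇑f) (⇑g) a) := by
    intro a
    obtain ⟨b, rfl⟩ : ∃ b : ℕ → A, a = fun k : Fin (m + n + 2) => b (k : ℕ) :=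
      ⟨fun k => if h : k < m + n + 2 then a ⟨k, h⟩ else 0, by funext k; simp⟩
    exact seq_identity μ α hmult m n f g hf hg b
  refine ⟨main, fun h1 h2 a => ?_⟩
  have h := main a
  have z1 : vcirc (⇑α) (⇑f) (homDelta (fun x y => μ x y) (⇑α) (n + 1) (⇑g)) a = 0 := by
    refine Finset.sum_eq_zero fun i _ => ?_
    have : circI (⇑α) i (⇑f) (homDelta (fun x y => μ x y) (⇑α) (n + 1) (⇑g)) a = 0 := by
      refine f.map_coord_zero i ?_
      simp [h2]
    rw [this, smul_zero]
  have z2 : ∀ c, vcirc (⇑α) (homDelta (fun x y => μ x y) (⇑α) (m + 1) (⇑f)) (⇑g) c = 0 := by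
    intro c
    refine Finset.sum_eq_zero fun i _ => ?_
    have : circI (⇑α) i (homDelta (fun x y => μ x y) (⇑α) (m + 1) (⇑f)) (⇑g) c = 0 := h1 _
    rw [this, smul_zero]
  rw [z1, z2, smul_zero, add_zero, zero_sub] at h
  have hn : ((-1 : ℤ) ^ n) * (-1) ^ n = 1 := by
    rw [← mul_pow]; simp
  have h' := congrArg (fun x => ((-1 : ℤ) ^ n) • x) h
  simp only [smul_smul, hn, one_smul] at h'
  rw [← h', pow_succ, mul_neg_one, neg_smul, smul_neg]
end

section
/- In a multiplicative hom-associative algebra, let f ∈ Z^m_α(A,A), g ∈ Zⁿ_α(A,A), h ∈ Z^p_α(A,A) be cocycles, and set H = Σ_{i=0}^{p-2} Σ_{j=m+i}^{m+p-2} (-1)^{(m-1)i + (n-1)j} (h ∘ᵢ f) ∘ⱼ g ∈ C^{m+n+p-2}_α(A,A). Then δ_α H = (-1)^{(m-1)n} [ h ∘ (f ∪_α g) - (-1)^{n(p-1)} (h ∘ f) ∪_α g - f ∪_α (h ∘ g) ]. Consequently, [f ∪_α g, h]_α - [f,h]_α ∪_α g - (-1)^{m(p-1)} f ∪_α [g,h]_α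 is a coboundary, so the Leibniz rule for the Gerstenhaber structure holds on H•_α(A,A). -/
/-- The cochain `H = Σ_{i=0}^{p-1} Σ_{j=m+1+i}^{m+p} (-1)^{mi+nj} (h ∘ᵢ f) ∘ⱼ g`
(for `h ∈ C^{p+1}_α = V^α_p`, `f ∈ C^{m+1}_α = V^α_m`, `g ∈ C^{n+1}_α = V^α_n`). -/
def bigH {A : Type*} [AddCommGroup A] (α : A → A) (m n p : ℕ)
    (h : (Fin (p + 1) → A) → A) (f : (Fin (m + 1) → A) → A)
    (g : (Fin (n + 1) → A) → A) : (Fin (m + n + p + 1) → A) → A := fun a =>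
  ∑ i : Fin (p + 1), ∑ j : Fin (p + m + 1),
    if (i : ℕ) < p ∧ m + 1 + (i : ℕ) ≤ (j : ℕ) ∧ (j : ℕ) ≤ m + p then
      ((-1 : ℤ) ^ (m * (i : ℕ) + n * (j : ℕ))) •
        circI α j (circI α i h f) g (reindex (by omega) a)
    else 0

namespace GerstAux

section operad
variable {A : Type*}

/-- Twisted insertion for functions of infinite sequences; `q` is the degree of `G`. -/
def circ (α : A → A) (q i : ℕ) (F G : (ℕ → A) → A) : (ℕ → A) → A := fun a =>
  F fun k => if k < i then α^[q] (a k) else if k = i then G (fun l => a (i + l))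
    else α^[q] (a (k + q))

/-- `F` depends on the first `n` entries only. -/
def Loc (n : ℕ) (F : (ℕ → A) → A) : Prop := ∀ a b : ℕ → A, (∀ i < n, a i = b i) → F a = F b

/-- `F` commutes with `α`. -/
def Cmp (α : A → A) (F : (ℕ → A) → A) : Prop := ∀ a : ℕ → A, α (F a) = F fun i => α (a i)

theorem Cmp.iter {α : A → A} {F : (ℕ → A) → A} (hF : Cmp α F) (r : ℕ) (a : ℕ → A) :
    α^[r] (F a) = F fun i => α^[r] (a i) := by
  induction r generalizing a with
  | zero => rfl
  | succ r ih => simp only [Function.iterate_succ_apply]; rw [hF, ih]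

theorem circ_seq (α : A → A) (q r i j : ℕ) (hj : j ≤ q) (F G H : (ℕ → A) → A) :
    circ α r (i + j) (circ α q i F G) H = circ α (q + r) i F (circ α r j G H) := by
  funext a
  unfold circ
  congr 1
  funext k
  rcases lt_trichotomy k i with h | h | h
  · have : k < i + j := by omega
    simp [h, this, Function.iterate_add_apply]
  · subst h
    simp only [lt_irrefl, if_false, if_true]
    congr 1
    funext l
    simp only [Nat.add_lt_add_iff_left, Nat.add_left_cancel_iff, Nat.add_assoc]
  · have h1 : ¬ k < i := by omega
    have h2 : ¬ k = i := by omega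
    have h3 : ¬ k + q < i + j := by omega
    have h4 : ¬ k + q = i + j := by omega
    simp [h1, h2, h3, h4, Function.iterate_add_apply, Nat.add_assoc]

theorem circ_par (α : A → A) (q r i j : ℕ) (hij : i < j) (F G H : (ℕ → A) → A)
    (hG : Cmp α G) (hGl : Loc (q + 1) G) (hH : Cmp α H) :
    circ α r (j + q) (circ α q i F G) H = circ α q i (circ α r j F H) G := by
  funext a
  unfold circ
  congr 1
  funext k
  have comm : ∀ x, α^[q] (α^[r] x) = α^[r] (α^[q] x) := fun x => by
    rw [← Function.iterate_add_apply, ← Function.iterate_add_apply, Nat.add_comm]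
  rcases lt_trichotomy k i with h | h | h
  · have : k < j + q := by omega
    have h' : k < j := by omega
    simp [h, this, h', comm]
  · subst h
    simp only [lt_irrefl, if_false, if_true, hij]
    rw [hG.iter]
    apply hGl
    intro l hl
    have : k + l < j + q := by omega
    simp [this]
  · have h1 : ¬ k < i := by omega
    have h2 : ¬ k = i := by omega
    rcases lt_trichotomy k j with h' | h' | h'
    · have : k + q < j + q := by omega
      simp [h1, h2, h', comm]
    · subst h'
      simp only [h1, h2, lt_irrefl, if_false, if_true]
      rw [hH.iter]
      congr 1
      funext l
      have h3 : ¬ k + l < i := by omega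
      have h4 : ¬ k + l = i := by omega
      simp only [h3, h4, if_false]
      congr 2; omega
    · have h3 : ¬ k + q < j + q := by omega
      have h4 : ¬ k + q = j + q := by omega
      have h5 : ¬ k < j := by omega
      have h6 : ¬ k = j := by omega
      have h7 : ¬ k + r < i := by omega
      have h8 : ¬ k + r = i := by omega
      simp only [h1, h2, h3, h4, h5, h6, h7, h8, if_false, comm]
      congr 3; omega

theorem Cmp.circ {α : A → A} {F G : (ℕ → A) → A} (hF : Cmp α F) (hG : Cmp α G) (q i : ℕ) :
    Cmp α (circ α q i F G) := by
  intro a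
  unfold GerstAux.circ
  rw [hF]
  congr 1
  funext k
  split_ifs
  · rw [← Function.iterate_succ_apply' α, Function.iterate_succ_apply]
  · rw [hG]
  · rw [← Function.iterate_succ_apply' α, Function.iterate_succ_apply]

theorem Loc.circ {α : A → A} {p q i : ℕ} {F G : (ℕ → A) → A} (hF : Loc (p + 1) F)
    (hG : Loc (q + 1) G) (hi : i ≤ p) : Loc (p + q + 1) (circ α q i F G) := by
  intro a b hab
  unfold GerstAux.circ
  apply hF
  intro k hk
  split_ifs
  · rw [hab]; omega
  · apply hG; intro l hl; apply hab; omega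
  · rw [hab]; omega

/-- faces -/
def face (α : A → A) (M : (ℕ → A) → A) (q k : ℕ) (F : (ℕ → A) → A) : (ℕ → A) → A :=
  if k = 0 then circ α q 1 M F else if k ≤ q + 1 then circ α 1 (k - 1) F M else circ α q 0 M F

theorem face_zero (α : A → A) (M : (ℕ → A) → A) (q : ℕ) (F : (ℕ → A) → A) :
    face α M q 0 F = circ α q 1 M F := by simp [face]

theorem face_mid (α : A → A) (M : (ℕ → A) → A) (q k : ℕ) (F : (ℕ → A) → A) (hk : k ≤ q) :
    face α M q (k + 1) F = circ α 1 k F M := by simp [face, hk]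

theorem face_last (α : A → A) (M : (ℕ → A) → A) (q : ℕ) (F : (ℕ → A) → A) :
    face α M q (q + 2) F = circ α q 0 M F := by simp [face]

variable {α : A → A} {M : (ℕ → A) → A}

theorem face_left {q m i k : ℕ} {F f : (ℕ → A) → A} (hM : Cmp α M) (hMl : Loc 2 M)
    (hf : Cmp α f) (hi : i ≤ q) (hk : k ≤ i) :
    face α M (q + m) k (circ α m i F f) = circ α m (i + 1) (face α M q k F) f := by
  rcases k with _ | k
  · rw [face_zero, face_zero, ← circ_seq α q m 1 i hi, Nat.add_comm 1 i]
  · rw [face_mid _ _ _ _ _ (by omega), face_mid _ _ _ _ _ (by omega)]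
    exact (circ_par α 1 m k i (by omega) F M f hM hMl hf).symm

theorem face_inner {q m i k : ℕ} {F f : (ℕ → A) → A} (hi : i ≤ q) (hk : k ≤ m) :
    face α M (q + m) (i + 1 + k) (circ α m i F f) =
      circ α (m + 1) i F (face α M m (k + 1) f) := by
  rw [show i + 1 + k = i + k + 1 by omega, face_mid _ _ _ _ _ (by omega),
    face_mid _ _ _ _ _ (by omega)]
  exact circ_seq α m 1 i k hk F f M

theorem face_right {q m i k : ℕ} {F f : (ℕ → A) → A} (hM : Cmp α M)
    (hf : Cmp α f) (hfl : Loc (m + 1) f) (hi : i ≤ q) (hk : i + 2 ≤ k) (hk' : k ≤ q + 2) :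
    face α M (q + m) (k + m) (circ α m i F f) = circ α m i (face α M q k F) f := by
  by_cases h : k = q + 2
  · subst h
    rw [show q + 2 + m = q + m + 2 by omega, face_last, face_last]
    rw [← circ_seq α q m 0 i hi, Nat.zero_add]
  · obtain ⟨k, rfl⟩ : ∃ k', k = k' + 1 := ⟨k - 1, by omega⟩
    rw [show k + 1 + m = k + m + 1 by omega, face_mid _ _ _ _ _ (by omega),
      face_mid _ _ _ _ _ (by omega)]
    exact circ_par α m 1 i k (by omega) F f M hf hfl hM

theorem cross_left {q m i : ℕ} {F f : (ℕ → A) → A} (hi : i ≤ q) :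
    circ α (m + 1) i F (face α M m 0 f) = circ α m (i + 1) (face α M q (i + 1) F) f := by
  rw [face_zero, face_mid _ _ _ _ _ hi, circ_seq α 1 m i 1 le_rfl, Nat.add_comm]

theorem cross_right {q m i : ℕ} {F f : (ℕ → A) → A} (hi : i ≤ q) :
    circ α (m + 1) i F (face α M m (m + 2) f) = circ α m i (face α M q (i + 1) F) f := by
  rw [face_last, face_mid _ _ _ _ _ hi]
  have := circ_seq α 1 m i 0 (by omega) F M f
  rw [Nat.add_comm 1 m] at this
  exact this.symm

/-- additivity in slot `s` -/
def SlotAdd [AddCommGroup A] (s : ℕ) (F : (ℕ → A) → A) : Prop :=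
  ∀ (b : ℕ → A) (x y : A), F (Function.update b s (x + y)) =
    F (Function.update b s x) + F (Function.update b s y)

theorem circ_eq_update (q i : ℕ) (F G : (ℕ → A) → A) (a : ℕ → A) :
    circ α q i F G a = F (Function.update
      (fun k => if k < i then α^[q] (a k) else α^[q] (a (k + q))) i (G fun l => a (i + l))) := by
  unfold circ
  congr 1
  funext k
  by_cases h : k = i
  · subst h; simp
  · simp [h]

variable [AddCommGroup A]

theorem circ_sum {q i : ℕ} {F : (ℕ → A) → A} (hF : SlotAdd i F) {ι : Type*} (s : Finset ι)
    (c : ι → ℤ) (G : ι → (ℕ → A) → A) (a : ℕ → A) :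
    circ α q i F (fun b => ∑ k ∈ s, c k • G k b) a = ∑ k ∈ s, c k • circ α q i F (G k) a := by
  simp only [circ_eq_update]
  generalize (fun k => if k < i then α^[q] (a k) else α^[q] (a (k + q))) = b
  let φ : A →+ A := AddMonoidHom.mk' (fun x => F (Function.update b i x)) (hF b)
  change φ _ = ∑ k ∈ s, c k • φ _
  rw [map_sum]
  simp only [map_zsmul]

/-- The coboundary of a function of degree `q`. -/
def del (α : A → A) (M : (ℕ → A) → A) (q : ℕ) (F : (ℕ → A) → A) : (ℕ → A) → A := fun a =>
  ∑ k ∈ Finset.range (q + 3), (-1 : ℤ) ^ k • face α M q k F a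

theorem partial_sum {q m i r : ℕ} {F f : (ℕ → A) → A} (hM : Cmp α M) (hMl : Loc 2 M)
    (hf : Cmp α f) (hfl : Loc (m + 1) f) (hi : i ≤ q) (hF : SlotAdd i F)
    (hfc : ∀ a, del α M m f a = 0) (hr : i + 2 ≤ r) (hr' : r ≤ q + 3) (a : ℕ → A) :
    ∑ k ∈ Finset.range (r + m), (-1 : ℤ) ^ k • face α M (q + m) k (circ α m i F f) a =
      ∑ k ∈ Finset.range (i + 2), (-1 : ℤ) ^ k • circ α m (i + 1) (face α M q k F) f a +
      ∑ k ∈ Finset.Ico (i + 1) r, (-1 : ℤ) ^ (k + m) • circ α m i (face α M q k F) f a := by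
  have key : circ α (m + 1) i F (del α M m f) a = 0 := by
    have h0 : del α M m f = fun b => ∑ k ∈ (∅ : Finset ℕ), (1 : ℤ) • (fun _ => (0 : A)) b := by
      funext b; simp [hfc]
    rw [h0, circ_sum hF (∅ : Finset ℕ) (fun _ => (1 : ℤ)) (fun _ _ => (0 : A))]
    simp
  unfold del at key
  rw [circ_sum hF, Finset.sum_range_succ, Finset.sum_range_succ', cross_left hi,
    cross_right hi] at key
  obtain ⟨r, rfl⟩ := Nat.exists_eq_add_of_le hr
  rw [← Finset.sum_range_add_sum_Ico _ (show i + 1 ≤ i + 2 + r + m by omega),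
    ← Finset.sum_Ico_consecutive _ (show i + 1 ≤ i + m + 2 by omega)
      (show i + m + 2 ≤ i + 2 + r + m by omega)]
  rw [Finset.sum_range_succ _ (i + 1), Finset.sum_eq_sum_Ico_succ_bot (show i + 1 < i + 2 + r by omega)]
  have e1 : ∑ k ∈ Finset.range (i + 1), (-1 : ℤ) ^ k • face α M (q + m) k (circ α m i F f) a =
      ∑ k ∈ Finset.range (i + 1), (-1 : ℤ) ^ k • circ α m (i + 1) (face α M q k F) f a := by
    refine Finset.sum_congr rfl fun k hk => ?_
    rw [face_left hM hMl hf hi (by have := Finset.mem_range.1 hk; omega)]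
  have e2 : ∑ k ∈ Finset.Ico (i + m + 2) (i + 2 + r + m),
        (-1 : ℤ) ^ k • face α M (q + m) k (circ α m i F f) a =
      ∑ k ∈ Finset.Ico (i + 1 + 1) (i + 2 + r),
        (-1 : ℤ) ^ (k + m) • circ α m i (face α M q k F) f a := by
    rw [show i + m + 2 = i + 1 + 1 + m by omega, ← Finset.sum_Ico_add']
    refine Finset.sum_congr rfl fun k hk => ?_
    have := Finset.mem_Ico.1 hk
    rw [face_right hM hf hfl hi (by omega) (by omega)]
  have e3 : ∑ k ∈ Finset.Ico (i + 1) (i + m + 2),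
        (-1 : ℤ) ^ k • face α M (q + m) k (circ α m i F f) a =
      (-1 : ℤ) ^ i • ∑ k ∈ Finset.range (m + 1),
        (-1 : ℤ) ^ (k + 1) • circ α (m + 1) i F (face α M m (k + 1) f) a := by
    rw [Finset.sum_Ico_eq_sum_range, show i + m + 2 - (i + 1) = m + 1 by omega, Finset.smul_sum]
    refine Finset.sum_congr rfl fun k hk => ?_
    rw [face_inner hi (by have := Finset.mem_range.1 hk; omega), smul_smul]
    congr 1; ring
  rw [e1, e2, e3]
  have e4 := eq_neg_of_add_eq_zero_left key
  rw [← sub_eq_zero, sub_eq_zero, ← eq_sub_iff_add_eq] at e4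
  rw [e4]
  simp only [pow_add, smul_sub, smul_neg, smul_smul]
  generalize circ α m (i + 1) (face α M q (i + 1) F) f a = X
  generalize circ α m i (face α M q (i + 1) F) f a = Y
  simp only [show (-1 : ℤ) ^ 2 = 1 from rfl, pow_zero, pow_one, mul_one, mul_neg, neg_mul, neg_smul]
  abel

theorem SlotAdd.circ {m i j : ℕ} {F f : (ℕ → A) → A} (hα : ∀ x y, α (x + y) = α x + α y)
    (hF : SlotAdd j F) (hfl : Loc (m + 1) f) (hij : i < j) :
    SlotAdd (j + m) (circ α m i F f) := by
  have hit : ∀ x y, α^[m] (x + y) = α^[m] x + α^[m] y := by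
    intro x y
    exact iterate_map_add (AddMonoidHom.mk' α hα) m x y
  have key : ∀ b x, GerstAux.circ α m i F f (Function.update b (j + m) x) =
      F (Function.update (fun k => if k < i then α^[m] (b k) else if k = i then
        f (fun l => b (i + l)) else α^[m] (b (k + m))) j (α^[m] x)) := by
    intro b x
    unfold GerstAux.circ
    congr 1
    funext k
    by_cases hk : k = j
    · subst hk
      have h1 : ¬ k < i := by omega
      have h2 : ¬ k = i := by omega
      simp [h1, h2]
    · rw [Function.update_of_ne hk]
      split_ifs with h1 h2
      · rw [Function.update_of_ne (by omega)]
      · apply hfl; intro l hl; rw [Function.update_of_ne (by omega)]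
      · rw [Function.update_of_ne (by omega)]
  intro b x y
  rw [key, key, key, hit, hF]

theorem triangle (p : ℕ) (Q : ℕ → ℕ → ℕ → A)
    (hQ : ∀ i j, i < j → j ≤ p + 1 → ∑ k ∈ Finset.range (p + 3), Q k i j = 0) :
    ∑ j ∈ Finset.range (p + 1), ∑ i ∈ Finset.range j,
      (∑ k ∈ Finset.range (i + 2), Q k (i + 1) (j + 1) +
        ∑ k ∈ Finset.Ico (i + 1) (j + 2), Q k i (j + 1) +
        ∑ k ∈ Finset.Ico (j + 1) (p + 3), Q k i j) =
    - (∑ j ∈ Finset.range (p + 1), Q 0 0 (j + 1) +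
       ∑ i ∈ Finset.range (p + 1), Q (i + 1) i (i + 1) +
       ∑ i ∈ Finset.range (p + 1), Q (p + 2) i (p + 1)) := by
  have tot : ∑ j ∈ Finset.range (p + 2), ∑ i ∈ Finset.range j,
      (∑ k ∈ Finset.range (i + 1), Q k i j + ∑ k ∈ Finset.Ico (i + 1) (j + 1), Q k i j +
        ∑ k ∈ Finset.Ico (j + 1) (p + 3), Q k i j) = 0 := by
    refine Finset.sum_eq_zero fun j hj => Finset.sum_eq_zero fun i hi => ?_
    have := Finset.mem_range.1 hj
    have := Finset.mem_range.1 hi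
    rw [← hQ i j (by omega) (by omega), add_assoc,
      Finset.sum_Ico_consecutive _ (by omega) (by omega),
      Finset.sum_range_add_sum_Ico _ (by omega)]
  simp only [Finset.sum_add_distrib] at tot ⊢
  have s1 : ∑ j ∈ Finset.range (p + 2), ∑ i ∈ Finset.range j, ∑ k ∈ Finset.range (i + 1), Q k i j
      = ∑ j ∈ Finset.range (p + 1), ∑ i ∈ Finset.range j,
          ∑ k ∈ Finset.range (i + 2), Q k (i + 1) (j + 1) +
        ∑ j ∈ Finset.range (p + 1), Q 0 0 (j + 1) := by
    rw [Finset.sum_range_succ', Finset.range_zero, Finset.sum_empty, add_zero,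
      ← Finset.sum_add_distrib]
    refine Finset.sum_congr rfl fun j _ => ?_
    rw [Finset.sum_range_succ']
    simp
  have s2 : ∑ j ∈ Finset.range (p + 2), ∑ i ∈ Finset.range j,
        ∑ k ∈ Finset.Ico (i + 1) (j + 1), Q k i j
      = ∑ j ∈ Finset.range (p + 1), ∑ i ∈ Finset.range j,
          ∑ k ∈ Finset.Ico (i + 1) (j + 2), Q k i (j + 1) +
        ∑ j ∈ Finset.range (p + 1), Q (j + 1) j (j + 1) := by
    rw [Finset.sum_range_succ', Finset.range_zero, Finset.sum_empty, add_zero,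
      ← Finset.sum_add_distrib]
    refine Finset.sum_congr rfl fun j _ => ?_
    rw [Finset.sum_range_succ]
    simp
  have s3 : ∑ j ∈ Finset.range (p + 2), ∑ i ∈ Finset.range j,
        ∑ k ∈ Finset.Ico (j + 1) (p + 3), Q k i j
      = ∑ j ∈ Finset.range (p + 1), ∑ i ∈ Finset.range j,
          ∑ k ∈ Finset.Ico (j + 1) (p + 3), Q k i j +
        ∑ i ∈ Finset.range (p + 1), Q (p + 2) i (p + 1) := by
    rw [Finset.sum_range_succ]
    congr 1
    refine Finset.sum_congr rfl fun j _ => ?_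
    simp
  rw [s1, s2, s3] at tot
  rw [eq_neg_iff_add_eq_zero, ← tot]
  abel

/-- `cup f g` for `f` of degree `m` and `g` of degree `n`. -/
def cup (α : A → A) (M : (ℕ → A) → A) (m n : ℕ) (F G : (ℕ → A) → A) : (ℕ → A) → A :=
  circ α n (m + 1) (circ α m 0 M F) G

theorem main_identity {m n p : ℕ} {f g h : (ℕ → A) → A} (hα : ∀ x y, α (x + y) = α x + α y)
    (hM : Cmp α M) (hMl : Loc 2 M)
    (hf : Cmp α f) (hg : Cmp α g) (hh : Cmp α h)
    (hfl : Loc (m + 1) f) (hgl : Loc (n + 1) g)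
    (hadd : ∀ i ≤ p, SlotAdd i h)
    (hfc : ∀ a, del α M m f a = 0) (hgc : ∀ a, del α M n g a = 0)
    (hhc : ∀ a, del α M p h a = 0) (a : ℕ → A) :
    ∑ j ∈ Finset.range (p + 1), ∑ i ∈ Finset.range j, ((-1 : ℤ) ^ (m * i + n * (j + m))) •
      del α M (p + m + n) (circ α n (j + m) (circ α m i h f) g) a =
    ((-1 : ℤ) ^ (m * (n + 1))) •
      (∑ i ∈ Finset.range (p + 1), ((-1 : ℤ) ^ ((m + n + 1) * i)) •
          circ α (m + n + 1) i h (cup α M m n f g) a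
        - ((-1 : ℤ) ^ ((n + 1) * p)) • ∑ i ∈ Finset.range (p + 1), ((-1 : ℤ) ^ (m * i)) •
          cup α M (p + m) n (circ α m i h f) g a
        - ∑ i ∈ Finset.range (p + 1), ((-1 : ℤ) ^ (n * i)) •
          cup α M m (p + n) f (circ α n i h g) a) := by
  set P : ℕ → ℕ → ℕ → A := fun k i j =>
    circ α n (j + m) (circ α m i (face α M p k h) f) g a with hP
  have dT : ∀ i j, i < j → j ≤ p →
      del α M (p + m + n) (circ α n (j + m) (circ α m i h f) g) a =
      ∑ k ∈ Finset.range (i + 2), (-1 : ℤ) ^ k • P k (i + 1) (j + 1) +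
        ∑ k ∈ Finset.Ico (i + 1) (j + 2), (-1 : ℤ) ^ (k + m) • P k i (j + 1) +
        ∑ k ∈ Finset.Ico (j + 1) (p + 3), (-1 : ℤ) ^ (k + m + n) • P k i j := by
    intro i j hij hjp
    unfold del
    rw [show p + m + n + 3 = p + m + 3 + n by omega,
      partial_sum hM hMl hg hgl (by omega) (SlotAdd.circ hα (hadd j hjp) hfl hij) hgc
        (by omega) (by omega)]
    congr 1
    · have := partial_sum (q := p) (r := j + 2) hM hMl hf hfl (by omega) (hadd i (by omega)) hfc (by omega)
        (by omega) (fun k => if k < j + m + 1 then α^[n] (a k) else if k = j + m + 1 then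
          g (fun l => a (j + m + 1 + l)) else α^[n] (a (k + n)))
      rw [show j + m + 2 = j + 2 + m by omega]
      refine this.trans ?_
      simp only [hP]
      rw [show j + 1 + m = j + m + 1 by omega]
      rfl
    · rw [show j + m + 1 = j + 1 + m by omega, show p + m + 3 = p + 3 + m by omega,
        ← Finset.sum_Ico_add']
      refine Finset.sum_congr rfl fun k hk => ?_
      have := Finset.mem_Ico.1 hk
      rw [face_right hM hf hfl (by omega) (by omega) (by omega)]
  set Q : ℕ → ℕ → ℕ → A := fun k i j => (-1 : ℤ) ^ (m * i + n * j + k) • P k i j with hQ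
  have tri := triangle p Q (by
    intro i j hij hj
    have := hhc (fun k => if k < i then α^[m] ((fun k => if k < j + m then α^[n] (a k) else
          if k = j + m then g (fun l => a (j + m + l)) else α^[n] (a (k + n))) k) else if k = i then
          f (fun l => (fun k => if k < j + m then α^[n] (a k) else
          if k = j + m then g (fun l => a (j + m + l)) else α^[n] (a (k + n))) (i + l)) else
          α^[m] ((fun k => if k < j + m then α^[n] (a k) else
          if k = j + m then g (fun l => a (j + m + l)) else α^[n] (a (k + n))) (k + m)))
    have h2 : ∑ k ∈ Finset.range (p + 3), (-1 : ℤ) ^ k • P k i j = 0 := this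
    simp only [hQ, pow_add, mul_smul]
    rw [← Finset.smul_sum, ← Finset.smul_sum, h2, smul_zero, smul_zero])
  have p1 : ∀ j ∈ Finset.range (p + 1), Q 0 0 (j + 1) =
      (-1 : ℤ) ^ (n * (j + 1)) • cup α M m (p + n) f (circ α n j h g) a := by
    intro j hj
    have := Finset.mem_range.1 hj
    simp only [hQ, hP, face_zero, cup]
    rw [circ_par α m n 0 (j + 1) (by omega) _ f g hf hfl hg, Nat.add_comm j 1,
      circ_seq α p n 1 j (by omega), Nat.add_comm m 1,
      circ_par α m (p + n) 0 1 (by omega) _ f _ hf hfl (hh.circ hg _ _)]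
    simp
  have p2 : ∀ i ∈ Finset.range (p + 1), Q (i + 1) i (i + 1) =
      (-1 : ℤ) ^ (m * i + n * (i + 1) + (i + 1)) •
        circ α (m + n + 1) i h (cup α M m n f g) a := by
    intro i hi
    have := Finset.mem_range.1 hi
    simp only [hQ, hP, cup]
    rw [face_mid _ _ _ _ _ (by omega)]
    have e := circ_seq α 1 m i 0 (by omega) h M f
    rw [Nat.add_zero] at e
    rw [e, show i + 1 + m = i + (m + 1) by omega, Nat.add_comm 1 m,
      circ_seq α (m + 1) n i (m + 1) le_rfl, show m + 1 + n = m + n + 1 by omega]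
  have p3 : ∀ i ∈ Finset.range (p + 1), Q (p + 2) i (p + 1) =
      (-1 : ℤ) ^ (m * i + n * (p + 1) + (p + 2)) • cup α M (p + m) n (circ α m i h f) g a := by
    intro i hi
    have := Finset.mem_range.1 hi
    simp only [hQ, hP, cup, face_last]
    have e := circ_seq α p m 0 i (by omega) M h f
    rw [Nat.zero_add] at e
    rw [e, show p + 1 + m = p + m + 1 by omega]
  rw [Finset.sum_congr rfl p1, Finset.sum_congr rfl p2, Finset.sum_congr rfl p3] at tri
  have sq : ∀ x : ℕ, ((-1 : ℤ) ^ x) * (-1) ^ x = 1 := fun x => by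
    rw [← mul_pow]; simp
  have lhs : ∑ j ∈ Finset.range (p + 1), ∑ i ∈ Finset.range j,
      ((-1 : ℤ) ^ (m * i + n * (j + m))) •
      del α M (p + m + n) (circ α n (j + m) (circ α m i h f) g) a =
      ((-1 : ℤ) ^ (m * n + m + n)) • ∑ j ∈ Finset.range (p + 1), ∑ i ∈ Finset.range j,
      (∑ k ∈ Finset.range (i + 2), Q k (i + 1) (j + 1) +
        ∑ k ∈ Finset.Ico (i + 1) (j + 2), Q k i (j + 1) +
        ∑ k ∈ Finset.Ico (j + 1) (p + 3), Q k i j) := by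
    rw [Finset.smul_sum]
    refine Finset.sum_congr rfl fun j hj => ?_
    rw [Finset.smul_sum]
    refine Finset.sum_congr rfl fun i hi => ?_
    have := Finset.mem_range.1 hi
    have := Finset.mem_range.1 hj
    rw [dT i j (by omega) (by omega)]
    simp only [smul_add, Finset.smul_sum, hQ, smul_smul, ← pow_add]
    have par : ∀ x y : ℕ, x % 2 = y % 2 → (-1 : ℤ) ^ x = (-1) ^ y := fun x y hxy => by
      rw [neg_one_pow_eq_pow_mod_two, hxy, ← neg_one_pow_eq_pow_mod_two]
    congr 1
    · congr 1
      · refine Finset.sum_congr rfl fun k hk => ?_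
        congr 1; apply par; ring_nf; try omega
      · refine Finset.sum_congr rfl fun k hk => ?_
        congr 1; apply par; ring_nf; try omega
    · refine Finset.sum_congr rfl fun k hk => ?_
      congr 1; apply par; ring_nf; try omega
  rw [lhs, tri]
  have par : ∀ x y : ℕ, x % 2 = y % 2 → (-1 : ℤ) ^ x = (-1) ^ y := fun x y hxy => by
    rw [neg_one_pow_eq_pow_mod_two, hxy, ← neg_one_pow_eq_pow_mod_two]
  have par' : ∀ x y : ℕ, (x + 1) % 2 = y % 2 → -(-1 : ℤ) ^ x = (-1) ^ y := fun x y hxy => by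
    rw [← par _ _ hxy, pow_succ]; ring
  simp only [smul_add, smul_sub, smul_neg, Finset.smul_sum, smul_smul, ← pow_add, neg_add]
  simp only [← Finset.sum_neg_distrib, sub_eq_add_neg, ← neg_smul]
  rw [add_comm (∑ j ∈ Finset.range (p + 1), _) (∑ j ∈ Finset.range (p + 1), _), add_assoc,
    add_comm (∑ j ∈ Finset.range (p + 1), _) (∑ j ∈ Finset.range (p + 1), _), ← add_assoc]
  congr 1
  · congr 1
    · refine Finset.sum_congr rfl fun i _ => ?_
      congr 1; apply par'; ring_nf; omega
    · refine Finset.sum_congr rfl fun i _ => ?_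
      congr 2; apply par; ring_nf; omega
  · refine Finset.sum_congr rfl fun i _ => ?_
    congr 2; apply par; ring_nf; omega

theorem cup_circ {m n p : ℕ} {f g h : (ℕ → A) → A}
    (hg : Cmp α g) (hh : Cmp α h) (hhl : Loc (p + 1) h) (a : ℕ → A) :
    ∑ i ∈ Finset.range (m + n + 2), (-1 : ℤ) ^ (p * i) • circ α p i (cup α M m n f g) h a =
      ∑ i ∈ Finset.range (m + 1), (-1 : ℤ) ^ (p * i) • cup α M (m + p) n (circ α p i f h) g a +
      (-1 : ℤ) ^ ((m + 1) * p) • ∑ i ∈ Finset.range (n + 1), (-1 : ℤ) ^ (p * i) •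
        cup α M m (n + p) f (circ α p i g h) a := by
  rw [show m + n + 2 = (m + 1) + (n + 1) by omega, Finset.sum_range_add, Finset.smul_sum]
  congr 1
  · refine Finset.sum_congr rfl fun i hi => ?_
    have := Finset.mem_range.1 hi
    unfold cup
    rw [← circ_par α p n i (m + 1) (by omega) _ h g hh hhl hg]
    have e := circ_seq α m p 0 i (by omega) M f h
    rw [Nat.zero_add] at e
    rw [e, show m + 1 + p = m + p + 1 by omega]
  · refine Finset.sum_congr rfl fun i hi => ?_
    have := Finset.mem_range.1 hi
    unfold cup
    rw [circ_seq α n p (m + 1) i (by omega), smul_smul]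
    congr 1; ring

end operad

section bridge

/-- View a function of a finite tuple as a function of sequences. -/
def E {A : Type*} {n : ℕ} (F : (Fin n → A) → A) : (ℕ → A) → A := fun a => F fun i => a i

theorem E_circI {A : Type*} (α : A → A) {m n : ℕ} (i : Fin (m + 1))
    (f : (Fin (m + 1) → A) → A) (g : (Fin (n + 1) → A) → A) :
    E (circI α i f g) = circ α n i (E f) (E g) := rfl

theorem E_loc {A : Type*} {n : ℕ} (F : (Fin n → A) → A) : Loc n (E F) := by
  intro a b hab
  unfold E
  congr 1
  funext i
  exact hab i i.2

theorem E_cmp {A : Type*} {α : A → A} {n : ℕ} {F : (Fin n → A) → A} (hF : IsCompat α F) :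
    Cmp α (E F) := fun a => hF _

theorem exists_ext {A : Type*} [Zero A] {n : ℕ} (a : Fin n → A) :
    ∃ b : ℕ → A, a = fun i : Fin n => b i :=
  ⟨fun k => if h : k < n then a ⟨k, h⟩ else 0, by funext i; simp⟩

theorem homDelta_eq {A : Type*} [AddCommGroup A] (μ : A → A → A) (α : A → A) (q : ℕ)
    (F : (Fin (q + 1) → A) → A) (b : ℕ → A) :
    homDelta μ α (q + 1) F (fun i => b i) =
      del α (fun a => μ (a 0) (a 1)) q (E F) b := by
  unfold homDelta del
  rw [Finset.sum_range_succ, Finset.sum_range_succ', face_zero, face_last, Finset.sum_range,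
    add_comm (∑ i : Fin (q + 1), _) (_ • _)]
  congr 1
  · congr 1
    · simp [circ, E, Nat.add_comm]
    · refine Finset.sum_congr rfl fun i _ => ?_
      rw [face_mid _ _ _ _ _ (by omega)]
      simp only [circ, E]
      congr 2
      funext j
      split_ifs with h1 h2
      · rfl
      · simp [h2]
      · rfl
  · simp [circ, E, Nat.add_comm 1 q]

theorem vcirc_eq {A : Type*} [AddCommGroup A] (α : A → A) {m n : ℕ}
    (f : (Fin (m + 1) → A) → A) (g : (Fin (n + 1) → A) → A) :
    E (vcirc α f g) = fun b => ∑ i ∈ Finset.range (m + 1), ((-1 : ℤ) ^ (n * i)) •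
      circ α n i (E f) (E g) b := by
  funext b
  rw [Finset.sum_range]
  rfl

theorem vbracket_eq {A : Type*} [AddCommGroup A] (α : A → A) {m n : ℕ}
    (f : (Fin (m + 1) → A) → A) (g : (Fin (n + 1) → A) → A) :
    E (vbracket α f g) = fun b => E (vcirc α f g) b -
      ((-1 : ℤ) ^ (m * n)) • E (vcirc α g f) b := rfl

/-- The direct formula for the cup product. -/
def cupF {A : Type*} (μ : A → A → A) (α : A → A) (m n : ℕ) (F G : (ℕ → A) → A) :
    (ℕ → A) → A := fun b => μ (α^[n] (F b)) (α^[m] (G fun i => b (m + 1 + i)))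

theorem cupProd_eq {A : Type*} (μ : A → A → A) (α : A → A) {m n : ℕ}
    (f : (Fin (m + 1) → A) → A) (g : (Fin (n + 1) → A) → A) :
    E (cupProd μ α f g) = cupF μ α m n (E f) (E g) := rfl

theorem cupF_eq {A : Type*} (μ : A → A → A) (α : A → A) (m n : ℕ) (F G : (ℕ → A) → A)
    (hF : Cmp α F) (hFl : Loc (m + 1) F) :
    cupF μ α m n F G = cup α (fun a => μ (a 0) (a 1)) m n F G := by
  funext b
  unfold cupF cup circ
  simp only [lt_irrefl, if_false, if_true, Nat.zero_add, Nat.not_lt_zero]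
  rw [hF.iter]
  congr 1
  · apply hFl
    intro i hi
    simp [hi]
  · rw [if_neg (by omega), if_neg (by omega), if_pos (by omega)]

/-- `F` comes from a multilinear map. -/
def IsML (K : Type*) [Field K] {A : Type*} [AddCommGroup A] [Module K A] {n : ℕ}
    (F : (Fin n → A) → A) : Prop := ∃ M : MultilinearMap K (fun _ : Fin n => A) A, ⇑M = F

variable {K : Type*} [Field K] {A : Type*} [AddCommGroup A] [Module K A]

theorem IsML.sum {n : ℕ} {ι : Type*} (s : Finset ι) (F : ι → (Fin n → A) → A)
    (hF : ∀ i ∈ s, IsML K (F i)) : IsML K (fun a => ∑ i ∈ s, F i a) := by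
  classical
  choose! M hM using hF
  refine ⟨∑ i ∈ s, M i, ?_⟩
  funext a
  rw [MultilinearMap.sum_apply]
  exact Finset.sum_congr rfl fun i hi => by rw [hM i hi]

theorem IsML.zsmul {n : ℕ} {F : (Fin n → A) → A} (hF : IsML K F) (c : ℤ) :
    IsML K (fun a => c • F a) := by
  obtain ⟨M, rfl⟩ := hF
  refine ⟨(c : K) • M, ?_⟩
  funext a
  simp [Int.cast_smul_eq_zsmul]

theorem IsML.reindex {n n' : ℕ} (e : n = n') {F : (Fin n → A) → A} (hF : IsML K F) :
    IsML K (fun a => F (reindex e a)) := by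
  subst e
  exact hF

theorem IsML.zero {n : ℕ} : IsML K (fun _ : Fin n → A => (0 : A)) := ⟨0, rfl⟩

theorem IsML.circI {m n : ℕ} (α : A →ₗ[K] A) (i : Fin (m + 1)) {f : (Fin (m + 1) → A) → A}
    {g : (Fin (n + 1) → A) → A} (hf : IsML K f) (hg : IsML K g) :
    IsML K (circI α i f g) := by
  obtain ⟨f, rfl⟩ := hf
  obtain ⟨g, rfl⟩ := hg
  have key : ∀ (a : Fin (m + n + 1) → A) (c : Fin (m + n + 1)),
      ∃ (k : Fin (m + 1)) (b : Fin (m + 1) → A) (ψ : A →ₗ[K] A),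
        ∀ x, _root_.circI α i f g (Function.update a c x) = f (Function.update b k (ψ x)) := by
    intro a c
    set b : Fin (m + 1) → A := fun k => if (k : ℕ) < (i : ℕ) then α^[n] (a ⟨(k : ℕ), by omega⟩)
      else if (k : ℕ) = (i : ℕ) then g (fun l => a ⟨(i : ℕ) + (l : ℕ), by omega⟩)
      else α^[n] (a ⟨(k : ℕ) + n, by omega⟩) with hb
    rcases lt_or_ge (c : ℕ) i with h1 | h1
    · refine ⟨⟨c, by omega⟩, b, α ^ n, fun x => ?_⟩
      unfold _root_.circI
      congr 1
      funext k
      by_cases hk : k = ⟨c, by omega⟩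
      · subst hk
        simp [h1, Module.End.pow_apply]
      · rw [Function.update_of_ne hk]
        have hk' : (k : ℕ) ≠ c := fun h => hk (Fin.ext h)
        simp only [hb]
        split_ifs with h2 h3
        · rw [Function.update_of_ne (fun h => hk' (congrArg Fin.val h))]
        · congr 1
          funext l
          rw [Function.update_of_ne]
          intro h
          have := congrArg Fin.val h
          simp at this
          omega
        · rw [Function.update_of_ne]
          intro h
          have := congrArg Fin.val h
          simp at this
          omega
    · rcases lt_or_ge ((i : ℕ) + n) c with h2 | h2
      · refine ⟨⟨c - n, by omega⟩, b, α ^ n, fun x => ?_⟩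
        unfold _root_.circI
        congr 1
        funext k
        by_cases hk : k = ⟨c - n, by omega⟩
        · subst hk
          rw [Function.update_self, Module.End.pow_apply]
          simp only
          rw [if_neg (by omega), if_neg (by omega)]
          congr 1
          have : (⟨(c : ℕ) - n + n, by omega⟩ : Fin (m + n + 1)) = c := Fin.ext (by simp; omega)
          rw [this, Function.update_self]
        · rw [Function.update_of_ne hk]
          have hk' : (k : ℕ) ≠ c - n := fun h => hk (Fin.ext h)
          simp only [hb]
          split_ifs with h3 h4
          · rw [Function.update_of_ne]
            intro h
            have := congrArg Fin.val h
            simp at this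
            omega
          · congr 1
            funext l
            rw [Function.update_of_ne]
            intro h
            have := congrArg Fin.val h
            simp at this
            omega
          · rw [Function.update_of_ne]
            intro h
            have := congrArg Fin.val h
            simp at this
            omega
      · refine ⟨i, b, g.toLinearMap (fun l => a ⟨(i : ℕ) + (l : ℕ), by omega⟩)
          ⟨c - i, by omega⟩, fun x => ?_⟩
        unfold _root_.circI
        congr 1
        funext k
        by_cases hk : k = i
        · subst hk
          simp only [lt_irrefl, if_false, if_true, Function.update_self,
            MultilinearMap.toLinearMap_apply]
          congr 1
          funext l
          by_cases hl : l = ⟨c - k, by omega⟩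
          · subst hl
            rw [Function.update_self]
            have : (⟨(k : ℕ) + ((c : ℕ) - k), by omega⟩ : Fin (m + n + 1)) = c :=
              Fin.ext (by simp; omega)
            simp only
            rw [this, Function.update_self]
          · rw [Function.update_of_ne hl, Function.update_of_ne]
            intro h
            have := congrArg Fin.val h
            simp at this
            exact hl (Fin.ext (by simp; omega))
        · rw [Function.update_of_ne hk]
          have hk' : (k : ℕ) ≠ i := fun h => hk (Fin.ext h)
          simp only [hb]
          rw [if_neg hk', if_neg hk']
          split_ifs with h3
          · rw [Function.update_of_ne]
            intro h
            have := congrArg Fin.val h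
            simp at this
            omega
          · rw [Function.update_of_ne]
            intro h
            have := congrArg Fin.val h
            simp at this
            omega
  refine ⟨MultilinearMap.mk' (_root_.circI α i f g) ?_ ?_, rfl⟩
  · intro a c x y
    obtain ⟨k, b, ψ, hψ⟩ := key a c
    rw [hψ, hψ, hψ, map_add, MultilinearMap.map_update_add]
  · intro a c r x
    obtain ⟨k, b, ψ, hψ⟩ := key a c
    rw [hψ, hψ, map_smul, MultilinearMap.map_update_smul]

theorem isML_bigH (α : A →ₗ[K] A) {m n p : ℕ} {h : (Fin (p + 1) → A) → A}
    {f : (Fin (m + 1) → A) → A} {g : (Fin (n + 1) → A) → A} (hh : IsML K h) (hf : IsML K f)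
    (hg : IsML K g) : IsML K (bigH α m n p h f g) := by
  unfold bigH
  refine IsML.sum _ _ fun i _ => IsML.sum _ _ fun j _ => ?_
  split_ifs
  · exact (IsML.reindex _ ((hh.circI α i hf).circI α j hg)).zsmul _
  · exact IsML.zero

theorem bigH_eq (α : A → A) {m n p : ℕ} (h : (Fin (p + 1) → A) → A)
    (f : (Fin (m + 1) → A) → A) (g : (Fin (n + 1) → A) → A) :
    E (bigH α m n p h f g) = fun b => ∑ j ∈ Finset.range (p + 1), ∑ i ∈ Finset.range j,
      ((-1 : ℤ) ^ (m * i + n * (j + m))) •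
        circ α n (j + m) (circ α m i (E h) (E f)) (E g) b := by
  funext b
  have e1 : E (bigH α m n p h f g) b = ∑ i ∈ Finset.range (p + 1),
      ∑ j ∈ Finset.range (p + m + 1), if i < p ∧ m + 1 + i ≤ j ∧ j ≤ m + p then
      ((-1 : ℤ) ^ (m * i + n * j)) • circ α n j (circ α m i (E h) (E f)) (E g) b else 0 := by
    rw [Finset.sum_range]
    simp only [Finset.sum_range]
    rfl
  rw [e1, Finset.sum_comm, show p + m + 1 = m + (p + 1) by omega, Finset.sum_range_add]
  rw [Finset.sum_eq_zero (s := Finset.range m), zero_add]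
  · refine Finset.sum_congr rfl fun j hj => ?_
    have hj' := Finset.mem_range.1 hj
    rw [← Finset.sum_filter]
    have : Finset.filter (fun i => i < p ∧ m + 1 + i ≤ m + j ∧ m + j ≤ m + p)
        (Finset.range (p + 1)) = Finset.range j := by
      ext i
      simp only [Finset.mem_filter, Finset.mem_range]
      omega
    rw [this]
    simp only [Nat.add_comm m j]
  · intro j hj
    have hj' := Finset.mem_range.1 hj
    refine Finset.sum_eq_zero fun i _ => ?_
    rw [if_neg (by omega)]

theorem compat_bigH (α : A →ₗ[K] A) {m n p : ℕ} {h : (Fin (p + 1) → A) → A}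
    {f : (Fin (m + 1) → A) → A} {g : (Fin (n + 1) → A) → A} (hh : IsCompat α h)
    (hf : IsCompat α f) (hg : IsCompat α g) : IsCompat α (bigH α m n p h f g) := by
  intro a
  obtain ⟨b, rfl⟩ := exists_ext a
  change α (E (bigH α m n p h f g) b) = E (bigH α m n p h f g) (fun i => α (b i))
  rw [bigH_eq]
  simp only [map_sum, map_zsmul]
  refine Finset.sum_congr rfl fun j _ => Finset.sum_congr rfl fun i _ => ?_
  rw [((E_cmp hh).circ (E_cmp hf) _ _).circ (E_cmp hg) n (j + m) b]

theorem slotAdd_E {p i : ℕ} (h : MultilinearMap K (fun _ : Fin (p + 1) => A) A) (hi : i ≤ p) :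
    SlotAdd i (E h) := by
  have key : ∀ b x, E h (Function.update b i x) =
      h (Function.update (fun k : Fin (p + 1) => b k) ⟨i, by omega⟩ x) := by
    intro b x
    unfold E
    congr 1
    funext k
    by_cases hk : k = ⟨i, by omega⟩
    · subst hk; simp
    · rw [Function.update_of_ne hk, Function.update_of_ne (fun h => hk (Fin.ext h))]
  intro b x y
  rw [key, key, key, MultilinearMap.map_update_add]

theorem face_sum (μ : A →ₗ[K] A →ₗ[K] A) (α : A → A) (q k : ℕ) {ι : Type*} (s : Finset ι)
    (c : ι → ℤ) (F : ι → (ℕ → A) → A) (b : ℕ → A) :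
    face α (fun a => μ (a 0) (a 1)) q k (fun b => ∑ i ∈ s, c i • F i b) b =
      ∑ i ∈ s, c i • face α (fun a => μ (a 0) (a 1)) q k (F i) b := by
  unfold face
  split_ifs
  · simp [circ]
  · simp [circ]
  · simp [circ, LinearMap.sum_apply]

theorem del_sum (μ : A →ₗ[K] A →ₗ[K] A) (α : A → A) (q : ℕ) {ι : Type*} (s : Finset ι)
    (c : ι → ℤ) (F : ι → (ℕ → A) → A) (b : ℕ → A) :
    del α (fun a => μ (a 0) (a 1)) q (fun b => ∑ i ∈ s, c i • F i b) b =
      ∑ i ∈ s, c i • del α (fun a => μ (a 0) (a 1)) q (F i) b := by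
  unfold del
  simp only [face_sum, Finset.smul_sum]
  rw [Finset.sum_comm]
  simp only [smul_smul, mul_comm]

theorem cupF_sum_left (μ : A →ₗ[K] A →ₗ[K] A) (α : A →ₗ[K] A) (m n : ℕ) {ι : Type*}
    (s : Finset ι) (c : ι → ℤ) (F : ι → (ℕ → A) → A) (G : (ℕ → A) → A) (b : ℕ → A) :
    cupF (fun x y => μ x y) α m n (fun b => ∑ i ∈ s, c i • F i b) G b =
      ∑ i ∈ s, c i • cupF (fun x y => μ x y) α m n (F i) G b := by
  simp only [cupF, ← Module.End.pow_apply, map_sum, map_zsmul, LinearMap.sum_apply,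
    LinearMap.smul_apply]

theorem cupF_sum_right (μ : A →ₗ[K] A →ₗ[K] A) (α : A →ₗ[K] A) (m n : ℕ) {ι : Type*}
    (s : Finset ι) (c : ι → ℤ) (F : ι → (ℕ → A) → A) (G : (ℕ → A) → A) (b : ℕ → A) :
    cupF (fun x y => μ x y) α m n G (fun b => ∑ i ∈ s, c i • F i b) b =
      ∑ i ∈ s, c i • cupF (fun x y => μ x y) α m n G (F i) b := by
  simp only [cupF, ← Module.End.pow_apply, map_sum, map_zsmul]

theorem cupF_sub_left (μ : A →ₗ[K] A →ₗ[K] A) (α : A →ₗ[K] A) (m n : ℕ) (c : ℤ)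
    (F F' : (ℕ → A) → A) (G : (ℕ → A) → A) (b : ℕ → A) :
    cupF (fun x y => μ x y) α m n (fun b => F b - c • F' b) G b =
      cupF (fun x y => μ x y) α m n F G b - c • cupF (fun x y => μ x y) α m n F' G b := by
  simp only [cupF, ← Module.End.pow_apply, map_sub, map_zsmul, LinearMap.sub_apply,
    LinearMap.smul_apply]

theorem cupF_sub_right (μ : A →ₗ[K] A →ₗ[K] A) (α : A →ₗ[K] A) (m n : ℕ) (c : ℤ)
    (F F' : (ℕ → A) → A) (G : (ℕ → A) → A) (b : ℕ → A) :
    cupF (fun x y => μ x y) α m n G (fun b => F b - c • F' b) b =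
      cupF (fun x y => μ x y) α m n G F b - c • cupF (fun x y => μ x y) α m n G F' b := by
  simp only [cupF, ← Module.End.pow_apply, map_sub, map_zsmul]

end bridge
end GerstAux

/-- For cocycles `f ∈ Z^{m+1}_α`, `g ∈ Z^{n+1}_α`, `h ∈ Z^{p+1}_α`, the cochain `H`
lies in `C^{m+n+p+1}_α` and satisfies
`δ_α H = (-1)^{m(n+1)} [h ∘ (f ∪_α g) - (-1)^{(n+1)p} (h ∘ f) ∪_α g - f ∪_α (h ∘ g)]`.
Consequently `[f ∪_α g, h]_α - [f, h]_α ∪_α g - (-1)^{(m+1)p} f ∪_α [g, h]_α` is a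
coboundary, so the Gerstenhaber Leibniz rule holds on cohomology. -/
theorem gerstenhaber_Leibniz_up_to_coboundary
    {K : Type*} [Field K] [CharZero K] {A : Type*} [AddCommGroup A] [Module K A]
    (μ : A →ₗ[K] A →ₗ[K] A) (α : A →ₗ[K] A)
    (hassoc : ∀ a b c : A, μ (α a) (μ b c) = μ (μ a b) (α c))
    (hmult : ∀ a b : A, α (μ a b) = μ (α a) (α b))
    (m n p : ℕ)
    (f : MultilinearMap K (fun _ : Fin (m + 1) => A) A)
    (g : MultilinearMap K (fun _ : Fin (n + 1) => A) A)
    (h : MultilinearMap K (fun _ : Fin (p + 1) => A) A)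
    (hf : IsCompat (⇑α) (⇑f)) (hg : IsCompat (⇑α) (⇑g)) (hh : IsCompat (⇑α) (⇑h))
    (hfc : ∀ a, homDelta (fun x y => μ x y) (⇑α) (m + 1) (⇑f) a = 0)
    (hgc : ∀ a, homDelta (fun x y => μ x y) (⇑α) (n + 1) (⇑g) a = 0)
    (hhc : ∀ a, homDelta (fun x y => μ x y) (⇑α) (p + 1) (⇑h) a = 0) :
    -- H is a cochain
    (IsCompat (⇑α) (bigH (⇑α) m n p (⇑h) (⇑f) (⇑g)) ∧
     ∃ M : MultilinearMap K (fun _ : Fin (m + n + p + 1) => A) A,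
        ⇑M = bigH (⇑α) m n p (⇑h) (⇑f) (⇑g)) ∧
    -- δ_α H = (-1)^{m(n+1)} [ h ∘ (f ∪ g) - (-1)^{(n+1)p} (h ∘ f) ∪ g - f ∪ (h ∘ g) ]
    (∀ a : Fin (m + n + p + 2) → A,
      homDelta (fun x y => μ x y) (⇑α) (m + n + p + 1)
          (bigH (⇑α) m n p (⇑h) (⇑f) (⇑g)) a
        = ((-1 : ℤ) ^ (m * (n + 1))) •
            (vcirc (⇑α) (⇑h) (cupProd (fun x y => μ x y) (⇑α) (⇑f) (⇑g))
                (reindex (by omega) a)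
              - ((-1 : ℤ) ^ ((n + 1) * p)) •
                  cupProd (fun x y => μ x y) (⇑α) (vcirc (⇑α) (⇑h) (⇑f)) (⇑g)
                    (reindex (by omega) a)
              - cupProd (fun x y => μ x y) (⇑α) (⇑f) (vcirc (⇑α) (⇑h) (⇑g))
                  (reindex (by omega) a))) ∧
    -- consequently the Leibniz defect is a coboundary
    (∃ W : MultilinearMap K (fun _ : Fin (m + n + p + 1) => A) A,
      IsCompat (⇑α) (⇑W) ∧
      ∀ a : Fin (m + n + p + 2) → A,
        vbracket (⇑α) (cupProd (fun x y => μ x y) (⇑α) (⇑f) (⇑g)) (⇑h)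
            (reindex (by omega) a)
          - cupProd (fun x y => μ x y) (⇑α) (vbracket (⇑α) (⇑f) (⇑h)) (⇑g)
              (reindex (by omega) a)
          - ((-1 : ℤ) ^ ((m + 1) * p)) •
              cupProd (fun x y => μ x y) (⇑α) (⇑f) (vbracket (⇑α) (⇑g) (⇑h))
                (reindex (by omega) a)
        = homDelta (fun x y => μ x y) (⇑α) (m + n + p + 1) (⇑W) a) := by
  have hM : GerstAux.Cmp (⇑α) (fun a => μ (a 0) (a 1)) := fun a => hmult _ _
  have hMl : GerstAux.Loc 2 (fun a : ℕ → A => μ (a 0) (a 1)) := fun a b hab => by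
    simp only [hab 0 (by omega), hab 1 (by omega)]
  have ef := GerstAux.E_cmp hf
  have eg := GerstAux.E_cmp hg
  have eh := GerstAux.E_cmp hh
  have lf := GerstAux.E_loc (⇑f)
  have lg := GerstAux.E_loc (⇑g)
  have lh := GerstAux.E_loc (⇑h)
  have hcomp := GerstAux.compat_bigH α hh hf hg
  have hML := GerstAux.isML_bigH (K := K) α ⟨h, rfl⟩ ⟨f, rfl⟩ ⟨g, rfl⟩
  have main : ∀ a : Fin (m + n + p + 2) → A,
      homDelta (fun x y => μ x y) (⇑α) (m + n + p + 1)
          (bigH (⇑α) m n p (⇑h) (⇑f) (⇑g)) a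
        = ((-1 : ℤ) ^ (m * (n + 1))) •
            (vcirc (⇑α) (⇑h) (cupProd (fun x y => μ x y) (⇑α) (⇑f) (⇑g))
                (reindex (by omega) a)
              - ((-1 : ℤ) ^ ((n + 1) * p)) •
                  cupProd (fun x y => μ x y) (⇑α) (vcirc (⇑α) (⇑h) (⇑f)) (⇑g)
                    (reindex (by omega) a)
              - cupProd (fun x y => μ x y) (⇑α) (⇑f) (vcirc (⇑α) (⇑h) (⇑g))
                  (reindex (by omega) a)) := by
    intro a
    obtain ⟨b, rfl⟩ := GerstAux.exists_ext a
    have id := GerstAux.main_identity (p := p) (map_add α) hM hMl ef eg eh lf lg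
      (fun i hi => GerstAux.slotAdd_E h hi)
      (fun a => by rw [← GerstAux.homDelta_eq (fun x y => μ x y)]; exact hfc _)
      (fun a => by rw [← GerstAux.homDelta_eq (fun x y => μ x y)]; exact hgc _)
      (fun a => by rw [← GerstAux.homDelta_eq (fun x y => μ x y)]; exact hhc _) b
    have l : homDelta (fun x y => μ x y) (⇑α) (m + n + p + 1)
          (bigH (⇑α) m n p (⇑h) (⇑f) (⇑g)) (fun i => b i) = _ :=
      GerstAux.homDelta_eq (fun x y => μ x y) _ _ _ b
    rw [l, GerstAux.bigH_eq]
    have r1 : vcirc (⇑α) (⇑h) (cupProd (fun x y => μ x y) (⇑α) (⇑f) (⇑g))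
        (reindex (by omega) fun i : Fin (m + n + p + 2) => b i) =
        GerstAux.E (vcirc (⇑α) (⇑h) (cupProd (fun x y => μ x y) (⇑α) (⇑f) (⇑g))) b := rfl
    have r2 : cupProd (fun x y => μ x y) (⇑α) (vcirc (⇑α) (⇑h) (⇑f)) (⇑g)
        (reindex (by omega) fun i : Fin (m + n + p + 2) => b i) =
        GerstAux.E (cupProd (fun x y => μ x y) (⇑α) (vcirc (⇑α) (⇑h) (⇑f)) (⇑g)) b := rfl
    have r3 : cupProd (fun x y => μ x y) (⇑α) (⇑f) (vcirc (⇑α) (⇑h) (⇑g))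
        (reindex (by omega) fun i : Fin (m + n + p + 2) => b i) =
        GerstAux.E (cupProd (fun x y => μ x y) (⇑α) (⇑f) (vcirc (⇑α) (⇑h) (⇑g))) b := rfl
    rw [r1, r2, r3, GerstAux.vcirc_eq, GerstAux.cupProd_eq, GerstAux.cupProd_eq,
      GerstAux.cupProd_eq, GerstAux.vcirc_eq, GerstAux.vcirc_eq, GerstAux.cupF_sum_left,
      GerstAux.cupF_sum_right, GerstAux.cupF_eq _ _ _ _ _ _ ef lf]
    have c2 : ∀ i ∈ Finset.range (p + 1), ((-1 : ℤ) ^ (m * i)) •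
        GerstAux.cupF (fun x y => μ x y) (⇑α) (p + m) n
          (GerstAux.circ (⇑α) m i (GerstAux.E ⇑h) (GerstAux.E ⇑f)) (GerstAux.E ⇑g) b =
        ((-1 : ℤ) ^ (m * i)) • GerstAux.cup (⇑α) (fun a => μ (a 0) (a 1)) (p + m) n
          (GerstAux.circ (⇑α) m i (GerstAux.E ⇑h) (GerstAux.E ⇑f)) (GerstAux.E ⇑g) b := by
      intro i hi
      rw [GerstAux.cupF_eq _ _ _ _ _ _ (eh.circ ef _ _)
        (lh.circ lf (by have := Finset.mem_range.1 hi; omega))]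
    rw [Finset.sum_congr rfl c2]
    simp only [GerstAux.cupF_eq _ _ _ _ _ _ ef lf]
    rw [← id]
    have one : ∀ x : A, x = (1 : ℤ) • x := fun x => (one_smul ℤ x).symm
    have e := GerstAux.del_sum μ (⇑α) (m + n + p) (Finset.range (p + 1)) (fun _ => 1)
      (fun j b => ∑ i ∈ Finset.range j, ((-1 : ℤ) ^ (m * i + n * (j + m))) •
        GerstAux.circ (⇑α) n (j + m) (GerstAux.circ (⇑α) m i (GerstAux.E ⇑h) (GerstAux.E ⇑f))
          (GerstAux.E ⇑g) b) b
    simp only [one_smul, GerstAux.del_sum] at e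
    rw [e, show m + n + p = p + m + n by omega]
  refine ⟨⟨hcomp, hML⟩, main, ?_⟩
  obtain ⟨W, hW⟩ := hML
  set s : ℤ := -((-1 : ℤ) ^ ((m + n + 1) * p) * (-1 : ℤ) ^ (m * (n + 1))) with hs
  refine ⟨s • W, ?_, ?_⟩
  · intro a
    have := hcomp a
    rw [← hW] at this
    simp only [MultilinearMap.smul_apply, map_zsmul, this]
  · intro a
    have hm := main a
    have lin : homDelta (fun x y => μ x y) (⇑α) (m + n + p + 1) (⇑(s • W)) a =
        s • homDelta (fun x y => μ x y) (⇑α) (m + n + p + 1)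
          (bigH (⇑α) m n p (⇑h) (⇑f) (⇑g)) a := by
      rw [← hW]
      simp only [homDelta, MultilinearMap.smul_apply, map_zsmul, smul_add, Finset.smul_sum,
        LinearMap.smul_apply, smul_comm s]
    rw [lin, hm]
    clear hm lin
    obtain ⟨b, rfl⟩ := GerstAux.exists_ext a
    have r1 : vbracket (⇑α) (cupProd (fun x y => μ x y) (⇑α) (⇑f) (⇑g)) (⇑h)
        (reindex (by omega) fun i : Fin (m + n + p + 2) => b i) =
        GerstAux.E (vcirc (⇑α) (cupProd (fun x y => μ x y) (⇑α) (⇑f) (⇑g)) (⇑h)) b -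
        ((-1 : ℤ) ^ ((m + n + 1) * p)) •
          vcirc (⇑α) (⇑h) (cupProd (fun x y => μ x y) (⇑α) (⇑f) (⇑g))
            (reindex (by omega) fun i : Fin (m + n + p + 2) => b i) := rfl
    have r2 : cupProd (fun x y => μ x y) (⇑α) (vbracket (⇑α) (⇑f) (⇑h)) (⇑g)
        (reindex (by omega) fun i : Fin (m + n + p + 2) => b i) =
        GerstAux.cupF (fun x y => μ x y) (⇑α) (m + p) n (GerstAux.E (vcirc (⇑α) (⇑f) (⇑h)))
          (GerstAux.E ⇑g) b - ((-1 : ℤ) ^ (m * p)) •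
        cupProd (fun x y => μ x y) (⇑α) (vcirc (⇑α) (⇑h) (⇑f)) (⇑g)
        (reindex (by omega) fun i : Fin (m + n + p + 2) => b i) := by
      have := GerstAux.cupF_sub_left μ α (m + p) n ((-1 : ℤ) ^ (m * p))
        (GerstAux.E (vcirc (⇑α) (⇑f) (⇑h))) (GerstAux.E (vcirc (⇑α) (⇑h) (⇑f)))
        (GerstAux.E ⇑g) b
      refine this.trans ?_
      congr 2
      exact congrArg (fun t => GerstAux.cupF (fun x y => μ x y) (⇑α) t n
        (GerstAux.E (vcirc (⇑α) (⇑h) (⇑f))) (GerstAux.E ⇑g) b) (Nat.add_comm m p)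
    have r3 : cupProd (fun x y => μ x y) (⇑α) (⇑f) (vbracket (⇑α) (⇑g) (⇑h))
        (reindex (by omega) fun i : Fin (m + n + p + 2) => b i) =
        GerstAux.cupF (fun x y => μ x y) (⇑α) m (n + p) (GerstAux.E ⇑f)
          (GerstAux.E (vcirc (⇑α) (⇑g) (⇑h))) b - ((-1 : ℤ) ^ (n * p)) •
        cupProd (fun x y => μ x y) (⇑α) (⇑f) (vcirc (⇑α) (⇑h) (⇑g))
        (reindex (by omega) fun i : Fin (m + n + p + 2) => b i) := by
      have := GerstAux.cupF_sub_right μ α m (n + p) ((-1 : ℤ) ^ (n * p))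
        (GerstAux.E (vcirc (⇑α) (⇑g) (⇑h))) (GerstAux.E (vcirc (⇑α) (⇑h) (⇑g)))
        (GerstAux.E ⇑f) b
      refine this.trans ?_
      congr 2
      exact congrArg (fun t => GerstAux.cupF (fun x y => μ x y) (⇑α) m t
        (GerstAux.E ⇑f) (GerstAux.E (vcirc (⇑α) (⇑h) (⇑g))) b) (Nat.add_comm n p)
    rw [r1, r2, r3]
    have id := GerstAux.cup_circ (M := fun a => μ (a 0) (a 1)) (m := m) (n := n)
      (f := GerstAux.E ⇑f) eg eh lh b
    have c0 : GerstAux.E (vcirc (⇑α) (cupProd (fun x y => μ x y) (⇑α) (⇑f) (⇑g)) (⇑h)) b =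
        GerstAux.cupF (fun x y => μ x y) (⇑α) (m + p) n (GerstAux.E (vcirc (⇑α) (⇑f) (⇑h)))
          (GerstAux.E ⇑g) b + (-1 : ℤ) ^ ((m + 1) * p) •
        GerstAux.cupF (fun x y => μ x y) (⇑α) m (n + p) (GerstAux.E ⇑f)
          (GerstAux.E (vcirc (⇑α) (⇑g) (⇑h))) b := by
      rw [GerstAux.vcirc_eq, GerstAux.vcirc_eq, GerstAux.vcirc_eq, GerstAux.cupF_sum_left,
        GerstAux.cupF_sum_right, GerstAux.cupProd_eq, GerstAux.cupF_eq _ _ _ _ _ _ ef lf]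
      simp only [GerstAux.cupF_eq _ _ _ _ _ _ ef lf]
      refine id.trans ?_
      congr 1
      refine Finset.sum_congr rfl fun i hi => ?_
      rw [GerstAux.cupF_eq _ _ _ _ _ _ (ef.circ eh _ _)
        (lf.circ lh (by have := Finset.mem_range.1 hi; omega))]
    rw [c0]
    generalize GerstAux.cupF (fun x y => μ x y) (⇑α) (m + p) n
      (GerstAux.E (vcirc (⇑α) (⇑f) (⇑h))) (GerstAux.E ⇑g) b = U
    generalize GerstAux.cupF (fun x y => μ x y) (⇑α) m (n + p) (GerstAux.E ⇑f)
          (GerstAux.E (vcirc (⇑α) (⇑g) (⇑h))) b = V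
    generalize vcirc (⇑α) (⇑h) (cupProd (fun x y => μ x y) (⇑α) (⇑f) (⇑g)) _ = X
    generalize cupProd (fun x y => μ x y) (⇑α) (vcirc (⇑α) (⇑h) (⇑f)) (⇑g) _ = Y
    generalize cupProd (fun x y => μ x y) (⇑α) (⇑f) (vcirc (⇑α) (⇑h) (⇑g)) _ = Z
    have sq : ∀ x : ℕ, ((-1 : ℤ) ^ x) * (-1) ^ x = 1 := fun x => by
      rw [← mul_pow]; simp
    have s1 : s * (-1 : ℤ) ^ (m * (n + 1)) = -(-1 : ℤ) ^ ((m + n + 1) * p) := by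
      rw [hs, neg_mul, mul_assoc, sq, mul_one]
    have s2 : (-1 : ℤ) ^ ((m + n + 1) * p) * (-1) ^ ((n + 1) * p) = (-1) ^ (m * p) := by
      rw [show (m + n + 1) * p = m * p + (n + 1) * p by ring, pow_add, mul_assoc, sq, mul_one]
    have s3 : (-1 : ℤ) ^ ((m + 1) * p) * (-1) ^ (n * p) = (-1) ^ ((m + n + 1) * p) := by
      rw [← pow_add]; congr 1; ring
    rw [smul_smul, s1, smul_sub, smul_sub, smul_sub, smul_smul, smul_smul, s3, neg_mul, s2,
      neg_smul, neg_smul, neg_smul]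
    abel
end
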